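/- arXiv:1504.08245 — 3 statements merged into one kernel-verified Lean document; each statement's English description precedes it below -/
import Mathlib

section
/- Let d ≥ 1, r > 0, let ‖·‖ be an arbitrary norm on ℝ^d with V_d the Lebesgue volume of its unit ball, and let X be an ℝ^d-valued random vector whose law is absolutely continuous with density f_X, whose differential entropy h(X) is finite, and which satisfies H(⌊X⌋) < ∞. Then the Shannon lower bound is asymptotically tight: lim_{D↓0} ( R(D) − R_SLB(D) ) = 0, where R(D) is the rate-distortion function and R_SLB(D) = h(X) + (d/r)·log(1/D) − (d/r)·log( (r/d)·(V_d·Γ(1+d/r))^{r/d}·e ). -/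
open MeasureTheory ProbabilityTheory Real Filter Topology
open scoped ENNReal

/-- Componentwise integer part of a vector in ℝ^d. -/
noncomputable def intFloor (d : ℕ) (x : Fin d → ℝ) : Fin d → ℤ := fun i => ⌊x i⌋

/-- Discrete (Shannon) entropy, in nats, of the random element `V` under `P`,
valued in `[0,∞]`. -/
noncomputable def discEnt {Ω α : Type*} [MeasurableSpace Ω] (P : Measure Ω) (V : Ω → α) : ℝ≥0∞ :=
  ∑' a : α, ENNReal.ofReal (Real.negMulLog (P (V ⁻¹' {a})).toReal)

/-- Differential entropy of a measure on ℝ^d (w.r.t. Lebesgue measure),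
as a Bochner integral of `-f log f` where `f` is the Radon–Nikodym density. -/
noncomputable def diffEnt {d : ℕ} (μ : Measure (Fin d → ℝ)) : ℝ :=
  -∫ x, ((μ.rnDeriv volume x).toReal) * Real.log ((μ.rnDeriv volume x).toReal)

open Classical in
/-- Kullback–Leibler divergence of `μ` w.r.t. `ν`, valued in `[0,∞]`. -/
noncomputable def klDiv {α : Type*} [MeasurableSpace α] (μ ν : Measure α) : ℝ≥0∞ :=
  if μ ≪ ν ∧ Integrable (llr μ ν) μ then ENNReal.ofReal (∫ x, llr μ ν x ∂μ) else ⊤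

section Kernel

variable {d : ℕ} {r : ℝ} {ν : Seminorm ℝ (Fin d → ℝ)}

lemma volume_unitBall_mul_gamma (hd : 1 ≤ d) (hr : 0 < r) (hνdef : ∀ x, ν x = 0 → x = 0) :
    (volume {x : Fin d → ℝ | ν x ≤ 1}).toReal * Gamma (1 + (d : ℝ) / r)
      = ∫ x, exp (-(ν x) ^ r) := by
  have : Nonempty (Fin d) := ⟨⟨0, hd⟩⟩
  rw [measure_le_eq_lt volume (map_zero ν) (map_neg_eq_map ν) (map_add_le_add ν) (hνdef _)
      (fun t x => (map_smul_eq_mul ν t x).le),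
    measure_lt_one_eq_integral_div_gamma volume (map_zero ν) (map_neg_eq_map ν)
      (map_add_le_add ν) (hνdef _) (fun t x => (map_smul_eq_mul ν t x).le) hr]
  have hG : 0 < Gamma ((d : ℝ) / r + 1) := Gamma_pos_of_pos (by positivity)
  rw [Module.finrank_fin_fun, ENNReal.toReal_ofReal, add_comm 1, div_mul_cancel₀ _ hG.ne']
  exact div_nonneg (integral_nonneg fun x => (exp_pos _).le) hG.le

lemma integral_exp_neg_seminorm_rpow_pos (hr : 0 < r)
    (hνdef : ∀ x, ν x = 0 → x = 0) (hνcont : Continuous fun x => ν x) :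
    0 < ∫ x, exp (-(ν x) ^ r) := by
  have hopen : IsOpen {x : Fin d → ℝ | ν x < 1} := isOpen_lt hνcont continuous_const
  have hpos : 0 < volume {x : Fin d → ℝ | ν x < 1} :=
    hopen.measure_pos volume ⟨0, by simp⟩
  rw [measure_lt_one_eq_integral_div_gamma volume (map_zero ν) (map_neg_eq_map ν)
    (map_add_le_add ν) (hνdef _) (fun t x => (map_smul_eq_mul ν t x).le) hr,
    ENNReal.ofReal_pos] at hpos
  have hG : 0 < Gamma ((Module.finrank ℝ (Fin d → ℝ) : ℝ) / r + 1) :=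
    Gamma_pos_of_pos (by positivity)
  exact (div_pos_iff_of_pos_right hG).1 hpos

lemma integrable_exp_neg_seminorm_rpow (hr : 0 < r)
    (hνdef : ∀ x, ν x = 0 → x = 0) (hνcont : Continuous fun x => ν x) :
    Integrable (fun x : Fin d → ℝ => exp (-(ν x) ^ r)) :=
  Integrable.of_integral_ne_zero (integral_exp_neg_seminorm_rpow_pos hr hνdef hνcont).ne'

lemma seminorm_smul_rpow {t : ℝ} (ht : 0 < t) (x : Fin d → ℝ) :
    (ν (t • x)) ^ r = t ^ r * (ν x) ^ r := by
  rw [map_smul_eq_mul, norm_of_nonneg ht.le, mul_rpow ht.le (apply_nonneg ν x)]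

lemma integral_exp_neg_mul_seminorm_rpow (hr : 0 < r) {s : ℝ} (hs : 0 < s) :
    ∫ x, exp (-(s * (ν x) ^ r)) = s ^ (-((d : ℝ) / r)) * ∫ x, exp (-(ν x) ^ r) := by
  have ht : 0 < s ^ (1 / r) := by positivity
  have h := Measure.integral_comp_smul_of_nonneg volume
    (fun x : Fin d → ℝ => exp (-(ν x) ^ r)) (s ^ (1 / r)) (hR := ht.le)
  have hts : (s ^ (1 / r)) ^ r = s := by rw [← rpow_mul hs.le, one_div_mul_cancel hr.ne', rpow_one]
  simp only [seminorm_smul_rpow ht, hts, Module.finrank_fin_fun, smul_eq_mul] at h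
  rw [h, ← rpow_natCast, ← rpow_mul hs.le, ← rpow_neg hs.le]
  congr 2
  ring

lemma integrable_exp_neg_mul_seminorm_rpow (hr : 0 < r)
    (hνdef : ∀ x, ν x = 0 → x = 0) (hνcont : Continuous fun x => ν x) {s : ℝ} (hs : 0 < s) :
    Integrable (fun x : Fin d → ℝ => exp (-(s * (ν x) ^ r))) := by
  apply Integrable.of_integral_ne_zero
  rw [integral_exp_neg_mul_seminorm_rpow hr hs]
  have := integral_exp_neg_seminorm_rpow_pos hr hνdef hνcont
  positivity

lemma mul_exp_neg_le (a : ℝ) : a * exp (-a) ≤ 2 * exp (-(1 / 2 * a)) := by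
  have h1 : exp (-a) = exp (-(1 / 2 * a)) * exp (-(1 / 2 * a)) := by
    rw [← exp_add]; ring_nf
  have h2 : a / 2 * exp (-(1 / 2 * a)) ≤ 1 := by
    rw [exp_neg, ← div_eq_mul_inv, div_le_one (exp_pos _)]
    linarith [add_one_le_exp (1 / 2 * a)]
  rw [h1]
  nlinarith [exp_pos (-(1 / 2 * a))]

lemma integrable_seminorm_rpow_mul_exp_neg (hr : 0 < r)
    (hνdef : ∀ x, ν x = 0 → x = 0) (hνcont : Continuous fun x => ν x) :
    Integrable (fun x : Fin d → ℝ => (ν x) ^ r * exp (-(ν x) ^ r)) := by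
  have hc : Continuous fun x : Fin d → ℝ => (ν x) ^ r := hνcont.rpow_const fun _ => Or.inr hr.le
  refine ((integrable_exp_neg_mul_seminorm_rpow hr hνdef hνcont (one_half_pos)).const_mul 2).mono'
    (by fun_prop) (.of_forall fun x => ?_)
  have : 0 ≤ (ν x) ^ r := rpow_nonneg (apply_nonneg ν x) r
  rw [norm_of_nonneg (by positivity)]
  exact mul_exp_neg_le _

/-- The function `δ ↦ ∫ exp (-(1 + δ) ν ^ r) - ∫ exp (-ν ^ r) + δ ∫ ν ^ r exp (-ν ^ r)` is
nonnegative and vanishes at `0`; its derivative there must vanish. -/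
lemma integral_seminorm_rpow_mul_exp_neg (hr : 0 < r)
    (hνdef : ∀ x, ν x = 0 → x = 0) (hνcont : Continuous fun x => ν x) :
    ∫ x : Fin d → ℝ, (ν x) ^ r * exp (-(ν x) ^ r) = (d : ℝ) / r * ∫ x, exp (-(ν x) ^ r) := by
  set Z := ∫ x, exp (-(ν x) ^ r) with hZ
  set M := ∫ x : Fin d → ℝ, (ν x) ^ r * exp (-(ν x) ^ r) with hM
  have key : ∀ s : ℝ, 0 < s → 0 ≤ s ^ (-((d : ℝ) / r)) * Z - Z + (s - 1) * M := by
    intro s hs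
    have hi := integrable_exp_neg_seminorm_rpow hr hνdef hνcont
    have hi' := integrable_exp_neg_mul_seminorm_rpow hr hνdef hνcont hs
    have hiM := integrable_seminorm_rpow_mul_exp_neg hr hνdef hνcont
    rw [hZ, hM, ← integral_exp_neg_mul_seminorm_rpow hr hs, ← integral_const_mul, ← integral_sub hi' hi,
      ← integral_add (f := fun x => exp (-(s * (ν x) ^ r)) - exp (-(ν x) ^ r)) (hi'.sub hi)
        (hiM.const_mul _)]
    refine integral_nonneg fun x => ?_
    have h1 : exp (-(s * (ν x) ^ r)) = exp (-(ν x) ^ r) * exp (-((s - 1) * (ν x) ^ r)) := by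
      rw [← exp_add]; ring_nf
    have h2 := add_one_le_exp (-((s - 1) * (ν x) ^ r))
    simp only [Pi.zero_apply, h1]
    nlinarith [exp_pos (-(ν x) ^ r)]
  have hder : HasDerivAt (fun s : ℝ => s ^ (-((d : ℝ) / r)) * Z - Z + (s - 1) * M)
      (-((d : ℝ) / r) * Z + M) 1 := by
    have h1 := (hasDerivAt_rpow_const (x := (1 : ℝ)) (p := -((d : ℝ) / r)) (Or.inl one_ne_zero))
    have h2 := ((h1.mul_const Z).sub_const Z).add (((hasDerivAt_id (1 : ℝ)).sub_const 1).mul_const M)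
    refine h2.congr_deriv ?_
    simp
  have hmin : IsLocalMin (fun s : ℝ => s ^ (-((d : ℝ) / r)) * Z - Z + (s - 1) * M) 1 := by
    filter_upwards [lt_mem_nhds (zero_lt_one : (0 : ℝ) < 1)] with s hs
    simpa using key s hs
  have := hmin.hasDerivAt_eq_zero hder
  linarith

lemma exists_norm_le_mul_seminorm
    (hνdef : ∀ x, ν x = 0 → x = 0) (hνcont : Continuous fun x => ν x) :
    ∃ C, 0 ≤ C ∧ ∀ x, ‖x‖ ≤ C * ν x := by
  rcases (Metric.sphere (0 : Fin d → ℝ) 1).eq_empty_or_nonempty with h | h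
  · refine ⟨0, le_rfl, fun x => ?_⟩
    by_cases hx : x = 0
    · simp [hx]
    · have : ‖x‖⁻¹ • x ∈ Metric.sphere (0 : Fin d → ℝ) 1 := by
        simp [norm_smul, norm_ne_zero_iff.2 hx]
      simp [h] at this
  · obtain ⟨y, hy, hmin⟩ := (isCompact_sphere (0 : Fin d → ℝ) 1).exists_isMinOn h hνcont.continuousOn
    have hy1 : ‖y‖ = 1 := by simpa using hy
    have hpos : 0 < ν y := (apply_nonneg ν y).lt_of_ne' fun h0 => by
      simp [hνdef y h0] at hy1
    refine ⟨(ν y)⁻¹, by positivity, fun x => ?_⟩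
    by_cases hx : x = 0
    · simp [hx]
    have hn : 0 < ‖x‖ := norm_pos_iff.2 hx
    have : ν y ≤ ν (‖x‖⁻¹ • x) := hmin (by simp [norm_smul, hn.ne'])
    rw [map_smul_eq_mul, norm_inv, norm_norm, inv_mul_eq_div, le_div_iff₀ hn] at this
    rwa [inv_mul_eq_div, le_div_iff₀ hpos, mul_comm]

lemma exists_mul_exp_neg_rpow_le (hr : 0 < r) :
    ∃ C, ∀ a : ℝ, 0 ≤ a → a * exp (-a ^ r) ≤ C * exp (-(1 / 2 * a ^ r)) := by
  -- for `a ≥ 1`, `a ≤ (a ^ r) ^ k ≤ k! 2 ^ k exp (a ^ r / 2)` once `k r ≥ 1`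
  obtain ⟨k, hk⟩ := exists_nat_ge (1 / r)
  refine ⟨1 + k.factorial * 2 ^ k, fun a ha => ?_⟩
  have h1 : exp (-a ^ r) = exp (-(1 / 2 * a ^ r)) * exp (-(1 / 2 * a ^ r)) := by
    rw [← exp_add]; ring_nf
  have har : 0 ≤ a ^ r := rpow_nonneg ha r
  suffices a ≤ (1 + k.factorial * 2 ^ k) * exp (1 / 2 * a ^ r) by
    rw [h1, ← mul_assoc]
    gcongr
    rwa [exp_neg, ← div_eq_mul_inv, div_le_iff₀ (exp_pos _)]
  have he : 1 ≤ exp (1 / 2 * a ^ r) := one_le_exp (by positivity)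
  have hf : (0 : ℝ) < k.factorial := by positivity
  rcases le_total a 1 with h | h
  · nlinarith [mul_nonneg (mul_nonneg hf.le (pow_nonneg zero_le_two k)) (exp_pos (1 / 2 * a ^ r)).le]
  · have h2 : a ≤ (a ^ r) ^ k := by
      rw [← rpow_mul_natCast ha]
      refine self_le_rpow_of_one_le h ?_
      rwa [div_le_iff₀ hr, mul_comm] at hk
    have h3 := pow_div_factorial_le_exp (1 / 2 * a ^ r) (by positivity) k
    rw [div_le_iff₀ hf, mul_pow, one_div, inv_pow, inv_mul_le_iff₀ (by positivity)] at h3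
    nlinarith [exp_pos (1 / 2 * a ^ r)]

lemma integrable_norm_mul_exp_neg_seminorm_rpow (hr : 0 < r)
    (hνdef : ∀ x, ν x = 0 → x = 0) (hνcont : Continuous fun x => ν x) :
    Integrable (fun x : Fin d → ℝ => ‖x‖ * exp (-(ν x) ^ r)) := by
  have hc : Continuous fun x : Fin d → ℝ => (ν x) ^ r := hνcont.rpow_const fun _ => Or.inr hr.le
  obtain ⟨C, hC, hνC⟩ := exists_norm_le_mul_seminorm hνdef hνcont
  obtain ⟨C', hC'⟩ := exists_mul_exp_neg_rpow_le hr
  refine ((integrable_exp_neg_mul_seminorm_rpow hr hνdef hνcont (one_half_pos)).const_mul (C * C')).mono'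
    (by fun_prop) (.of_forall fun x => ?_)
  rw [norm_of_nonneg (by positivity)]
  calc ‖x‖ * exp (-(ν x) ^ r) ≤ C * (ν x * exp (-(ν x) ^ r)) := by
        rw [← mul_assoc]; gcongr; exact hνC x
    _ ≤ C * (C' * exp (-(1 / 2 * (ν x) ^ r))) := by
        exact mul_le_mul_of_nonneg_left (hC' _ (apply_nonneg ν x)) hC
    _ = _ := by ring

end Kernel

section Gibbs

lemma one_sub_le_integral {α : Type*} [MeasurableSpace α] {ρ : Measure α} [IsProbabilityMeasure ρ]
    {a : α → ℝ} (ha : Integrable a ρ) {c : ℝ} (hc : 0 ≤ c)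
    (h : ∫⁻ x, ENNReal.ofReal (exp (-a x)) ∂ρ ≤ ENNReal.ofReal c) : 1 - c ≤ ∫ x, a x ∂ρ := by
  have hm : AEStronglyMeasurable (fun x => exp (-a x)) ρ :=
    continuous_exp.comp_aestronglyMeasurable ha.aestronglyMeasurable.neg
  have hi : Integrable (fun x => exp (-a x)) ρ := by
    refine ⟨hm, ?_⟩
    rw [hasFiniteIntegral_iff_ofReal (.of_forall fun x => (exp_pos _).le)]
    exact h.trans_lt ENNReal.ofReal_lt_top
  have h1 : ∫ x, exp (-a x) ∂ρ ≤ c := by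
    rw [integral_eq_lintegral_of_nonneg_ae (.of_forall fun x => (exp_pos _).le) hm]
    exact ENNReal.toReal_le_of_le_ofReal hc h
  have h2 : ∫ x, (1 - exp (-a x)) ∂ρ ≤ ∫ x, a x ∂ρ :=
    integral_mono ((integrable_const _).sub hi) ha fun x => by
      have := add_one_le_exp (-a x)
      simp only
      linarith
  rw [integral_sub (integrable_const _) hi, integral_const] at h2
  simp at h2
  linarith

lemma integrable_of_le_of_lintegral_exp_neg {α : Type*} [MeasurableSpace α] {ρ : Measure α}
    {a b : α → ℝ} (ha : AEMeasurable a ρ) (hb : Integrable b ρ) (hab : ∀ x, a x ≤ b x)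
    (h : ∫⁻ x, ENNReal.ofReal (exp (-a x)) ∂ρ ≠ ⊤) : Integrable a ρ := by
  have hi : Integrable (fun x => exp (-a x)) ρ := by
    refine ⟨(measurable_exp.comp_aemeasurable ha.neg).aestronglyMeasurable, ?_⟩
    rw [hasFiniteIntegral_iff_ofReal (.of_forall fun x => (exp_pos _).le)]
    exact h.lt_top
  refine (hb.norm.add hi).mono' ha.aestronglyMeasurable (.of_forall fun x => ?_)
  have h1 := add_one_le_exp (-a x)
  have h2 := exp_pos (-a x)
  have h3 := le_abs_self (b x)
  have h4 := abs_nonneg (b x)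
  simp only [Pi.add_apply, Real.norm_eq_abs]
  rw [abs_le]
  constructor <;> linarith [hab x]

end Gibbs

section LowerBound

variable {E : Type*} [MeasurableSpace E] [AddCommGroup E] [MeasurableSub₂ E] [MeasurableAdd E]
  {vol : Measure E} [SigmaFinite vol] [vol.IsAddRightInvariant]

/-- If `q` is a subprobability density, then the mutual information of `κ` is at least
`h(X) + E[log q (X - X̂)]`. -/
lemma neg_integral_log_rnDeriv_add_le_integral_llr
    {κ : Measure (E × E)} [IsProbabilityMeasure κ] {μ ρ : Measure E} [IsProbabilityMeasure μ]
    [IsProbabilityMeasure ρ]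
    (hfst : κ.map Prod.fst = μ) (hμ : μ ≪ vol)
    (hκ : κ ≪ μ.prod ρ) (hllr : Integrable (llr κ (μ.prod ρ)) κ)
    (hlog : Integrable (fun x => log (μ.rnDeriv vol x).toReal) μ)
    {q : E → ℝ} (hq : Measurable q) (hqpos : ∀ x, 0 < q x)
    (hq1 : ∫⁻ x, ENNReal.ofReal (q x) ∂vol ≤ 1)
    (hqlog : Integrable (fun p : E × E => log (q (p.1 - p.2))) κ) :
    -∫ x, log (μ.rnDeriv vol x).toReal ∂μ + ∫ p, log (q (p.1 - p.2)) ∂κ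
      ≤ ∫ p, llr κ (μ.prod ρ) p ∂κ := by
  set ℓ := κ.rnDeriv (μ.prod ρ) with hℓ
  set f := μ.rnDeriv vol with hf
  have hfm : Measurable f := Measure.measurable_rnDeriv _ _
  have hℓm : Measurable ℓ := Measure.measurable_rnDeriv _ _
  have hmp : MeasurePreserving (Prod.fst : E × E → E) κ μ := ⟨measurable_fst, hfst⟩
  have hlog' : Integrable (fun p : E × E => log (f p.1).toReal) κ :=
    hmp.integrable_comp_of_integrable hlog
  have hlogint : ∫ p, log (f p.1).toReal ∂κ = ∫ x, log (f x).toReal ∂μ := by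
    rw [← hfst, integral_map measurable_fst.aemeasurable]
    exact (measurable_log.comp hfm.ennreal_toReal).aestronglyMeasurable
  have hfae : ∀ᵐ p ∂κ, 0 < f p.1 ∧ f p.1 ≠ ⊤ := by
    have : ∀ᵐ x ∂μ, 0 < f x ∧ f x ≠ ⊤ :=
      (Measure.rnDeriv_pos hμ).and (hμ.ae_le (Measure.rnDeriv_ne_top μ vol))
    exact hmp.quasiMeasurePreserving.ae this
  have hℓae : ∀ᵐ p ∂κ, 0 < ℓ p ∧ ℓ p ≠ ⊤ :=
    (Measure.rnDeriv_pos hκ).and (hκ.ae_le (Measure.rnDeriv_ne_top κ _))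
  have hqm : Measurable fun p : E × E => ENNReal.ofReal (q (p.1 - p.2)) :=
    (hq.comp (measurable_fst.sub measurable_snd)).ennreal_ofReal
  have hexp : ∫⁻ p, ENNReal.ofReal (exp (-(llr κ (μ.prod ρ) p + log (f p.1).toReal
      - log (q (p.1 - p.2))))) ∂κ ≤ ENNReal.ofReal 1 := by
    calc _ = ∫⁻ p, (ℓ p)⁻¹ * ((f p.1)⁻¹ * ENNReal.ofReal (q (p.1 - p.2))) ∂κ := by
          refine lintegral_congr_ae ?_
          filter_upwards [hfae, hℓae] with p hp1 hp2
          have h1 : 0 < (f p.1).toReal := ENNReal.toReal_pos hp1.1.ne' hp1.2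
          have h2 : 0 < (ℓ p).toReal := ENNReal.toReal_pos hp2.1.ne' hp2.2
          rw [neg_sub, sub_eq_add_neg, neg_add, exp_add, exp_add, exp_log (hqpos _), exp_neg, exp_neg,
            exp_log h1, llr, exp_log h2, ENNReal.ofReal_mul (hqpos _).le,
            ENNReal.ofReal_mul (by positivity), ENNReal.ofReal_inv_of_pos h1,
            ENNReal.ofReal_inv_of_pos h2, ENNReal.ofReal_toReal hp1.2, ENNReal.ofReal_toReal hp2.2]
          ring
      _ = ∫⁻ p, ℓ p * ((ℓ p)⁻¹ * ((f p.1)⁻¹ * ENNReal.ofReal (q (p.1 - p.2)))) ∂(μ.prod ρ) := by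
          conv_lhs => rw [← Measure.withDensity_rnDeriv_eq κ (μ.prod ρ) hκ]
          rw [lintegral_withDensity_eq_lintegral_mul _ hℓm]
          · rfl
          · exact hℓm.inv.mul ((hfm.comp measurable_fst).inv.mul hqm)
      _ ≤ ∫⁻ p, (f p.1)⁻¹ * ENNReal.ofReal (q (p.1 - p.2)) ∂(μ.prod ρ) := by
          refine lintegral_mono fun p => ?_
          rw [← mul_assoc]
          exact mul_le_of_le_one_left' (ENNReal.mul_inv_le_one _)
      _ = ∫⁻ y, ∫⁻ x, (f x)⁻¹ * ENNReal.ofReal (q (x - y)) ∂μ ∂ρ :=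
          lintegral_prod_symm' _ ((hfm.comp measurable_fst).inv.mul hqm)
      _ ≤ ∫⁻ _, 1 ∂ρ := by
          refine lintegral_mono fun y => ?_
          have hqy : Measurable fun x => ENNReal.ofReal (q (x - y)) :=
            hqm.comp (measurable_id.prodMk measurable_const)
          calc _ = ∫⁻ x, f x * ((f x)⁻¹ * ENNReal.ofReal (q (x - y))) ∂vol := by
                conv_lhs => rw [← Measure.withDensity_rnDeriv_eq μ vol hμ]
                rw [lintegral_withDensity_eq_lintegral_mul _ hfm]
                · rfl
                · exact hfm.inv.mul hqy
            _ ≤ ∫⁻ x, ENNReal.ofReal (q (x - y)) ∂vol := by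
                refine lintegral_mono fun p => ?_
                rw [← mul_assoc]
                exact mul_le_of_le_one_left' (ENNReal.mul_inv_le_one _)
            _ = ∫⁻ x, ENNReal.ofReal (q x) ∂vol :=
                lintegral_sub_right_eq_self (fun x => ENNReal.ofReal (q x)) y
            _ ≤ 1 := hq1
      _ = ENNReal.ofReal 1 := by simp
  have h := one_sub_le_integral ((hllr.add hlog').sub hqlog) zero_le_one hexp
  rw [integral_sub' (hllr.add hlog') hqlog, integral_add' hllr hlog', hlogint] at h
  linarith

end LowerBound

section UpperBound

variable {E : Type*} [MeasurableSpace E] [AddCommGroup E] [MeasurableSub₂ E] [MeasurableAdd₂ E]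
  {vol : Measure E} [SigmaFinite vol] [vol.IsAddLeftInvariant]

/-- The joint law of `(X, X + W)` when `X ∼ μ` and `W` has density `q`. -/
lemma map_prod_add_eq_withDensity {μ : Measure E} [IsProbabilityMeasure μ]
    {Q : E → ℝ≥0∞} (hQ : Measurable Q) :
    (μ.prod (vol.withDensity Q)).map (fun p => (p.1, p.1 + p.2))
      = (μ.prod vol).withDensity (fun p => Q (p.2 - p.1)) := by
  have hT : MeasurePreserving (fun p : E × E => (p.1, p.1 + p.2)) (μ.prod vol) (μ.prod vol) :=
    measurePreserving_prod_add μ vol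
  have hQ' : Measurable fun p : E × E => Q (p.2 - p.1) :=
    hQ.comp (measurable_snd.sub measurable_fst)
  refine Measure.ext_of_lintegral _ fun φ hφ => ?_
  rw [lintegral_map hφ hT.measurable, prod_withDensity_right hQ,
    lintegral_withDensity_eq_lintegral_mul _ (by fun_prop) (by fun_prop),
    lintegral_withDensity_eq_lintegral_mul _ hQ' hφ, ← hT.lintegral_comp (hQ'.mul hφ)]
  simp

omit [MeasurableAdd₂ E] [vol.IsAddLeftInvariant] in
lemma map_snd_withDensity_sub {μ : Measure E} [IsProbabilityMeasure μ]
    {Q : E → ℝ≥0∞} (hQ : Measurable Q) :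
    ((μ.prod vol).withDensity (fun p => Q (p.2 - p.1))).map Prod.snd
      = vol.withDensity (fun y => ∫⁻ x, Q (y - x) ∂μ) := by
  have hQ' : Measurable fun p : E × E => Q (p.2 - p.1) :=
    hQ.comp (measurable_snd.sub measurable_fst)
  refine Measure.ext_of_lintegral _ fun φ hφ => ?_
  rw [lintegral_map hφ measurable_snd,
    lintegral_withDensity_eq_lintegral_mul _ hQ' (by fun_prop),
    lintegral_withDensity_eq_lintegral_mul _ hQ'.lintegral_prod_left' hφ,
    lintegral_prod_symm' _ (hQ'.mul (by fun_prop))]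
  refine lintegral_congr fun y => ?_
  simp only [Pi.mul_apply]
  exact lintegral_mul_const _ (hQ.comp (measurable_const.sub measurable_id))

/-- The mutual information of `X` and `X + W`, where `W` has a bounded positive density `q`, is at
most `-h(W) - E[F (X + W)] + c - 1` for every function `F` with `∫ exp F ≤ c`. -/
lemma klDiv_map_prod_add_le {μ : Measure E} [IsProbabilityMeasure μ]
    {q : E → ℝ} (hq : Measurable q) (hqpos : ∀ x, 0 < q x) {C : ℝ} (hqC : ∀ x, q x ≤ C)
    {ρ : Measure E} [IsProbabilityMeasure ρ] (hρ : ρ = vol.withDensity fun x => ENNReal.ofReal (q x))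
    (hlog : Integrable (fun x => log (q x)) ρ)
    {F : E → ℝ} (hF : Measurable F) (hFint : Integrable (fun p : E × E => F (p.1 + p.2)) (μ.prod ρ))
    {c : ℝ} (hc : 0 ≤ c) (hFc : ∫⁻ x, ENNReal.ofReal (exp (F x)) ∂vol ≤ ENNReal.ofReal c)
    {κ : Measure (E × E)} (hκ : κ = (μ.prod ρ).map fun p => (p.1, p.1 + p.2)) :
    klDiv κ ((κ.map Prod.fst).prod (κ.map Prod.snd))
      ≤ ENNReal.ofReal (∫ x, log (q x) ∂ρ - ∫ p, F (p.1 + p.2) ∂(μ.prod ρ) + c - 1) := by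
  set Q : E → ℝ≥0∞ := fun x => ENNReal.ofReal (q x) with hQdef
  have hQ : Measurable Q := hq.ennreal_ofReal
  have hQ' : Measurable fun p : E × E => Q (p.2 - p.1) :=
    hQ.comp (measurable_snd.sub measurable_fst)
  have hT : Measurable fun p : E × E => (p.1, p.1 + p.2) :=
    measurable_fst.prodMk (measurable_fst.add measurable_snd)
  have hκprob : IsProbabilityMeasure κ := by
    rw [hκ]; exact Measure.isProbabilityMeasure_map hT.aemeasurable
  have hfst : κ.map Prod.fst = μ := by
    rw [hκ, Measure.map_map measurable_fst hT]
    have : (Prod.fst ∘ fun p : E × E => (p.1, p.1 + p.2)) = Prod.fst := rfl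
    rw [this, Measure.map_fst_prod]
    simp
  set f : E → ℝ≥0∞ := fun y => ∫⁻ x, Q (y - x) ∂μ with hfdef
  have hfm : Measurable f := hQ'.lintegral_prod_left'
  have hκd : κ = (μ.prod vol).withDensity (fun p => Q (p.2 - p.1)) := by
    rw [hκ, hρ, map_prod_add_eq_withDensity hQ]
  have hsnd : κ.map Prod.snd = vol.withDensity f := by
    rw [hκd, map_snd_withDensity_sub hQ]
  have hfle : ∀ y, f y ≤ ENNReal.ofReal C := fun y => by
    calc f y ≤ ∫⁻ _, ENNReal.ofReal C ∂μ :=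
          lintegral_mono fun x => ENNReal.ofReal_le_ofReal (hqC _)
      _ = _ := by simp
  have hftop : ∀ y, f y ≠ ⊤ := fun y => ((hfle y).trans_lt ENNReal.ofReal_lt_top).ne
  have hfpos : ∀ y, f y ≠ 0 := fun y h => by
    rw [hfdef] at h
    simp only at h
    rw [lintegral_eq_zero_iff (by fun_prop)] at h
    obtain ⟨x, hx⟩ := h.exists
    simp [hQdef, not_le.2 (hqpos (y - x))] at hx
  have hfpos' : ∀ y, 0 < (f y).toReal := fun y => ENNReal.toReal_pos (hfpos y) (hftop y)
  set σ := κ.map Prod.snd with hσ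
  have hσprob : IsProbabilityMeasure σ := Measure.isProbabilityMeasure_map measurable_snd.aemeasurable
  set Lr : E × E → ℝ≥0∞ := fun p => (f p.2)⁻¹ * Q (p.2 - p.1) with hLr
  have hLm : Measurable Lr := (hfm.comp measurable_snd).inv.mul hQ'
  have hκσ : κ = (μ.prod σ).withDensity Lr := by
    rw [hκd, hsnd, prod_withDensity_right hfm,
      ← withDensity_mul (f := fun z : E × E => f z.2) _ (hfm.comp measurable_snd) hLm]
    congr 1
    ext p
    simp only [Pi.mul_apply, hLr]
    rw [← mul_assoc, ENNReal.mul_inv_cancel (hfpos _) (hftop _), one_mul]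
  have hac : κ ≪ μ.prod σ := by
    rw [hκσ]; exact withDensity_absolutelyContinuous _ _
  have hllr : llr κ (μ.prod σ) =ᵐ[κ] fun p => log (q (p.2 - p.1)) - log (f p.2).toReal := by
    have h1 : κ.rnDeriv (μ.prod σ) =ᵐ[μ.prod σ] Lr := by
      conv_lhs => rw [hκσ]
      exact Measure.rnDeriv_withDensity _ hLm
    filter_upwards [hac.ae_le h1] with p hp
    rw [llr, hp]
    simp only [hLr, hQdef, ENNReal.toReal_mul, ENNReal.toReal_inv,
      ENNReal.toReal_ofReal (hqpos _).le]
    rw [log_mul (inv_ne_zero (hfpos' _).ne') (hqpos _).ne', log_inv]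
    ring
  have hmeas1 : Measurable fun p : E × E => log (q (p.2 - p.1)) :=
    measurable_log.comp (hq.comp (measurable_snd.sub measurable_fst))
  have hint1 : Integrable (fun p : E × E => log (q (p.2 - p.1))) κ := by
    rw [hκ, integrable_map_measure hmeas1.aestronglyMeasurable hT.aemeasurable]
    simpa [Function.comp_def] using hlog.comp_snd μ
  have hval1 : ∫ p, log (q (p.2 - p.1)) ∂κ = ∫ x, log (q x) ∂ρ := by
    rw [hκ, integral_map hT.aemeasurable hmeas1.aestronglyMeasurable]
    simp only [add_sub_cancel_left]
    rw [integral_fun_snd (fun x => log (q x))]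
    simp
  have hadd : Measurable fun p : E × E => p.1 + p.2 := measurable_fst.add measurable_snd
  have hσ' : σ = (μ.prod ρ).map fun p => p.1 + p.2 := by
    rw [hσ, hκ, Measure.map_map measurable_snd hT]
    rfl
  have hFσ : Integrable F σ := by
    rw [hσ', integrable_map_measure hF.aestronglyMeasurable hadd.aemeasurable]
    exact hFint
  have hFσv : ∫ y, F y ∂σ = ∫ p, F (p.1 + p.2) ∂(μ.prod ρ) := by
    rw [hσ', integral_map hadd.aemeasurable hF.aestronglyMeasurable]
  have hexp : ∫⁻ y, ENNReal.ofReal (exp (-(log (f y).toReal - F y))) ∂σ ≤ ENNReal.ofReal c := by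
    have hm : Measurable fun y => ENNReal.ofReal (exp (F y)) := (measurable_exp.comp hF).ennreal_ofReal
    calc _ = ∫⁻ y, (f y)⁻¹ * ENNReal.ofReal (exp (F y)) ∂σ := by
          refine lintegral_congr fun y => ?_
          rw [neg_sub, sub_eq_add_neg, exp_add, exp_neg, exp_log (hfpos' y), mul_comm,
            ENNReal.ofReal_mul (by positivity), ENNReal.ofReal_inv_of_pos (hfpos' y),
            ENNReal.ofReal_toReal (hftop y)]
      _ = ∫⁻ y, f y * ((f y)⁻¹ * ENNReal.ofReal (exp (F y))) ∂vol := by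
          rw [hsnd, lintegral_withDensity_eq_lintegral_mul _ hfm (by fun_prop)]
          rfl
      _ ≤ ∫⁻ y, ENNReal.ofReal (exp (F y)) ∂vol := by
          refine lintegral_mono fun y => ?_
          rw [← mul_assoc]
          exact mul_le_of_le_one_left' (ENNReal.mul_inv_le_one _)
      _ ≤ _ := hFc
  have hlogm : Measurable fun y => log (f y).toReal := measurable_log.comp hfm.ennreal_toReal
  have hdiff : Integrable (fun y => log (f y).toReal - F y) σ := by
    refine integrable_of_le_of_lintegral_exp_neg (hlogm.sub hF).aemeasurable
      ((integrable_const (log C)).sub hFσ) (fun y => ?_) (hexp.trans_lt ENNReal.ofReal_lt_top).ne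
    simp only [Pi.sub_apply]
    gcongr
    · exact hfpos' y
    · exact ENNReal.toReal_le_of_le_ofReal ((hqpos 0).le.trans (hqC 0)) (hfle y)
  have hlogf : Integrable (fun y => log (f y).toReal) σ := by
    simpa [Pi.add_def] using hdiff.add hFσ
  have hge := one_sub_le_integral hdiff hc hexp
  rw [integral_sub hlogf hFσ, hFσv] at hge
  have hlogf' : Integrable (fun p : E × E => log (f p.2).toReal) κ := by
    rw [hσ, integrable_map_measure hlogm.aestronglyMeasurable measurable_snd.aemeasurable] at hlogf
    exact hlogf
  have hval2 : ∫ p, log (f p.2).toReal ∂κ = ∫ y, log (f y).toReal ∂σ := by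
    rw [hσ, integral_map measurable_snd.aemeasurable hlogm.aestronglyMeasurable]
  rw [hfst, klDiv, if_pos ⟨hac, (integrable_congr hllr).2 (hint1.sub hlogf')⟩,
    integral_congr_ae hllr, integral_sub hint1 hlogf', hval1, hval2]
  apply ENNReal.ofReal_le_ofReal
  linarith

end UpperBound

section LaplaceAverage

variable {E : Type*} [NormedAddCommGroup E] [MeasurableSpace E] [BorelSpace E]

/-- The convolution of `μ` with the (unnormalised) Laplace kernel `x ↦ exp (-‖x‖)`. -/
noncomputable def laplaceAverage (μ : Measure E) (x : E) : ℝ := ∫ y, exp (-‖x - y‖) ∂μ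

variable [SecondCountableTopology E] {μ : Measure E} [IsProbabilityMeasure μ]

lemma integrable_exp_neg_norm_sub (x : E) : Integrable (fun y => exp (-‖x - y‖)) μ :=
  (integrable_const (1 : ℝ)).mono' (by fun_prop) (.of_forall fun y => by
    rw [norm_of_nonneg (exp_pos _).le]
    exact exp_le_one_iff.2 (neg_nonpos.2 (norm_nonneg _)))

lemma laplaceAverage_pos (x : E) : 0 < laplaceAverage μ x :=
  integral_exp_pos (integrable_exp_neg_norm_sub x)

lemma laplaceAverage_le_one (x : E) : laplaceAverage μ x ≤ 1 := by
  calc laplaceAverage μ x ≤ ∫ _, (1 : ℝ) ∂μ :=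
        integral_mono (integrable_exp_neg_norm_sub x) (integrable_const _) fun y =>
          exp_le_one_iff.2 (neg_nonpos.2 (norm_nonneg _))
    _ = 1 := by simp

lemma log_laplaceAverage_le_add (x y : E) :
    log (laplaceAverage μ x) ≤ log (laplaceAverage μ y) + ‖x - y‖ := by
  have h : laplaceAverage μ x ≤ exp ‖x - y‖ * laplaceAverage μ y := by
    rw [laplaceAverage, laplaceAverage, ← integral_const_mul]
    refine integral_mono (integrable_exp_neg_norm_sub x)
      ((integrable_exp_neg_norm_sub y).const_mul _) fun z => ?_
    simp only
    rw [← exp_add, exp_le_exp]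
    have : ‖y - z‖ ≤ ‖x - y‖ + ‖x - z‖ := by
      rw [norm_sub_rev x y]
      exact norm_sub_le_norm_sub_add_norm_sub y x z
    linarith
  have := log_le_log (laplaceAverage_pos x) h
  rwa [log_mul (exp_pos _).ne' (laplaceAverage_pos y).ne', log_exp, add_comm] at this

lemma abs_log_laplaceAverage_sub_le (x y : E) :
    |log (laplaceAverage μ x) - log (laplaceAverage μ y)| ≤ ‖x - y‖ := by
  rw [abs_sub_le_iff]
  have h1 := log_laplaceAverage_le_add (μ := μ) x y
  have h2 := log_laplaceAverage_le_add (μ := μ) y x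
  rw [norm_sub_rev] at h2
  constructor <;> linarith

lemma continuous_log_laplaceAverage : Continuous fun x => log (laplaceAverage μ x) := by
  refine (LipschitzWith.of_dist_le_mul (K := 1) fun x y => ?_).continuous
  rw [Real.dist_eq, dist_eq_norm, NNReal.coe_one, one_mul]
  exact abs_log_laplaceAverage_sub_le x y

lemma lintegral_laplaceAverage_ne_top {vol : Measure E} [SFinite vol] [vol.IsAddRightInvariant]
    (h : Integrable (fun x => exp (-‖x‖)) vol) :
    ∫⁻ x, ENNReal.ofReal (laplaceAverage μ x) ∂vol ≠ ⊤ := by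
  have hm : Measurable fun p : E × E => ENNReal.ofReal (exp (-‖p.1 - p.2‖)) := by fun_prop
  have h1 : ∀ x, ENNReal.ofReal (laplaceAverage μ x)
      = ∫⁻ y, ENNReal.ofReal (exp (-‖x - y‖)) ∂μ := fun x =>
    ofReal_integral_eq_lintegral_ofReal (integrable_exp_neg_norm_sub x)
      (.of_forall fun y => (exp_pos _).le)
  simp_rw [h1]
  rw [lintegral_lintegral_swap hm.aemeasurable]
  have h2 : ∀ y, ∫⁻ x, ENNReal.ofReal (exp (-‖x - y‖)) ∂vol
      = ∫⁻ x, ENNReal.ofReal (exp (-‖x‖)) ∂vol := fun y =>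
    lintegral_sub_right_eq_self (fun x => ENNReal.ofReal (exp (-‖x‖))) y
  simp_rw [h2]
  simpa using h.lintegral_lt_top.ne

end LaplaceAverage

section FiniteEntropy

variable {d : ℕ} {μ : Measure (Fin d → ℝ)} [IsProbabilityMeasure μ]

lemma measurable_intFloor : Measurable (intFloor d) :=
  measurable_pi_lambda _ fun i => Int.measurable_floor.comp (measurable_pi_apply i)

lemma norm_sub_le_one_of_intFloor_eq {x y : Fin d → ℝ} (h : intFloor d x = intFloor d y) :
    ‖x - y‖ ≤ 1 := by
  refine (pi_norm_le_iff_of_nonneg zero_le_one).2 fun i => ?_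
  exact (Int.abs_sub_lt_one_of_floor_eq_floor (congrFun h i)).le

lemma exp_neg_one_mul_le_laplaceAverage (x : Fin d → ℝ) :
    exp (-1) * (μ (intFloor d ⁻¹' {intFloor d x})).toReal ≤ laplaceAverage μ x := by
  set S := intFloor d ⁻¹' {intFloor d x} with hSdef
  have hS : MeasurableSet S := measurable_intFloor (measurableSet_singleton _)
  calc exp (-1) * (μ S).toReal = ∫ y in S, exp (-1) ∂μ := by
        simp [measureReal_def, mul_comm]
    _ ≤ ∫ y in S, exp (-‖x - y‖) ∂μ := by
        refine setIntegral_mono_on (integrable_const _).integrableOn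
          (integrable_exp_neg_norm_sub x).integrableOn hS fun y hy => ?_
        rw [exp_le_exp, neg_le_neg_iff]
        exact norm_sub_le_one_of_intFloor_eq (Eq.symm hy)
    _ ≤ _ := setIntegral_le_integral (integrable_exp_neg_norm_sub x)
        (.of_forall fun y => (exp_pos _).le)

lemma integrable_log_laplaceAverage (hH : discEnt μ (intFloor d) ≠ ⊤) :
    Integrable (fun x => log (laplaceAverage μ x)) μ := by
  set p : (Fin d → ℤ) → ℝ := fun i => (μ (intFloor d ⁻¹' {i})).toReal with hp
  have hmap : ∀ i, μ.map (intFloor d) {i} = μ (intFloor d ⁻¹' {i}) := fun i =>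
    Measure.map_apply measurable_intFloor (measurableSet_singleton i)
  have hple : ∀ i, p i ≤ 1 := fun i => by
    simpa using ENNReal.toReal_mono ENNReal.one_ne_top (prob_le_one (μ := μ) (s := intFloor d ⁻¹' {i}))
  have hlogp : ∀ i, 0 ≤ -log (p i) := fun i => by
    have := log_nonpos ENNReal.toReal_nonneg (hple i)
    linarith
  have hent : ∫⁻ x, ENNReal.ofReal (-log (p (intFloor d x))) ∂μ = discEnt μ (intFloor d) := by
    rw [← lintegral_map (f := fun i => ENNReal.ofReal (-log (p i))) .of_discrete measurable_intFloor,
      lintegral_countable', discEnt]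
    refine tsum_congr fun i => ?_
    rw [hmap, negMulLog, ← ENNReal.ofReal_toReal (measure_ne_top μ (intFloor d ⁻¹' {i})),
      ← ENNReal.ofReal_mul (hlogp i), ENNReal.ofReal_toReal (measure_ne_top μ _)]
    congr 1
    simp only [hp]
    ring
  have hpm : Measurable fun x => -log (p (intFloor d x)) :=
    (Measurable.of_discrete (f := fun i => -log (p i))).comp measurable_intFloor
  have hint : Integrable (fun x => -log (p (intFloor d x))) μ := by
    refine ⟨hpm.aestronglyMeasurable, ?_⟩
    rw [hasFiniteIntegral_iff_ofReal (.of_forall fun x => hlogp _), hent]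
    exact hH.lt_top
  have hppos : ∀ᵐ x ∂μ, 0 < p (intFloor d x) := by
    refine ae_of_ae_map (p := fun i => 0 < p i) measurable_intFloor.aemeasurable ?_
    rw [ae_iff_of_countable]
    intro i hi
    rw [hmap] at hi
    exact ENNReal.toReal_pos hi (measure_ne_top _ _)
  refine ((integrable_const (1 : ℝ)).add hint).mono'
    continuous_log_laplaceAverage.aestronglyMeasurable ?_
  filter_upwards [hppos] with x hx
  have h1 := log_nonpos (laplaceAverage_pos x).le (laplaceAverage_le_one (μ := μ) x)
  have h2 := log_le_log (by positivity) (exp_neg_one_mul_le_laplaceAverage (μ := μ) x)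
  rw [log_mul (exp_pos _).ne' hx.ne', log_exp] at h2
  rw [Real.norm_eq_abs, abs_of_nonpos h1]
  simp only [Pi.add_apply]
  linarith

end FiniteEntropy

section ClampLog

/-- The logarithm truncated to the interval `[-n, n]`. -/
noncomputable def clampLog (n a : ℝ) : ℝ := log (max (exp (-n)) (min (exp n) a))

lemma measurable_clampLog (n : ℝ) : Measurable (clampLog n) := by
  unfold clampLog
  fun_prop

lemma exp_clampLog (n a : ℝ) : exp (clampLog n a) = max (exp (-n)) (min (exp n) a) :=
  exp_log (lt_max_of_lt_left (exp_pos _))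

lemma clampLog_mem_Icc {n : ℝ} (hn : 0 ≤ n) (a : ℝ) : clampLog n a ∈ Set.Icc (-n) n := by
  constructor <;> rw [← exp_le_exp, exp_clampLog]
  · exact le_max_left _ _
  · exact max_le (exp_le_exp.2 (by linarith)) (min_le_left _ _)

lemma exp_clampLog_le (n : ℝ) {a : ℝ} (ha : 0 ≤ a) : exp (clampLog n a) ≤ a + exp (-n) := by
  rw [exp_clampLog]
  exact max_le (by linarith) ((min_le_right _ _).trans (by linarith [exp_pos (-n)]))

lemma clampLog_of_pos (n : ℝ) {a : ℝ} (ha : 0 < a) : clampLog n a = max (-n) (min n (log a)) := by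
  rw [← exp_eq_exp, exp_clampLog, exp_monotone.map_max, exp_monotone.map_min, exp_log ha]

lemma abs_clampLog_le {n : ℝ} (hn : 0 ≤ n) {a : ℝ} (ha : 0 < a) : |clampLog n a| ≤ |log a| := by
  rw [clampLog_of_pos n ha, abs_le]
  have h1 := neg_abs_le (log a)
  have h2 := le_abs_self (log a)
  have h3 := abs_nonneg (log a)
  constructor
  · exact le_max_of_le_right (le_min (by linarith) h1)
  · exact max_le (by linarith) ((min_le_right _ _).trans h2)

lemma tendsto_clampLog {a : ℝ} (ha : 0 < a) :
    Tendsto (fun n : ℕ => clampLog n a) atTop (𝓝 (log a)) := by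
  obtain ⟨N, hN⟩ := exists_nat_ge |log a|
  refine tendsto_const_nhds.congr' ?_
  filter_upwards [eventually_ge_atTop N] with n hn
  have hn' : (N : ℝ) ≤ n := by exact_mod_cast hn
  have h := abs_le.1 (hN.trans hn')
  rw [clampLog_of_pos _ ha, min_eq_right h.2, max_eq_right h.1]

lemma exp_le_exp_add_of_le {n v : ℝ} (u : ℝ) (hv : v ≤ n) :
    exp v ≤ exp u + exp n * |u - v| := by
  have h1 : 1 - exp (u - v) ≤ |u - v| := by
    have := add_one_le_exp (u - v)
    have := neg_abs_le (u - v)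
    linarith
  have h2 : exp v - exp u = exp v * (1 - exp (u - v)) := by
    rw [mul_sub, ← exp_add]; ring_nf
  have h3 : exp v * (1 - exp (u - v)) ≤ exp n * |u - v| :=
    (mul_le_mul_of_nonneg_left h1 (exp_pos v).le).trans
      (mul_le_mul_of_nonneg_right (exp_le_exp.2 hv) (abs_nonneg _))
  linarith

end ClampLog

section ContinuousApproximation

variable {d : ℕ} {μ : Measure (Fin d → ℝ)} [IsProbabilityMeasure μ]

lemma integrable_exp_neg_norm : Integrable (fun x : Fin d → ℝ => exp (-‖x‖)) volume := by
  simpa using integrable_exp_neg_seminorm_rpow (d := d) (ν := normSeminorm ℝ _) one_pos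
    (fun x hx => by simpa using hx) continuous_norm

/-- The density relative to `laplaceAverage μ` can be replaced, at small cost, by a bounded
continuous function. -/
lemma exists_continuous_approx_log_rnDeriv (hac : μ ≪ volume)
    (hlog : Integrable (fun x => log (μ.rnDeriv volume x).toReal) μ)
    (hH : discEnt μ (intFloor d) ≠ ⊤) {ε : ℝ} (hε : 0 < ε) :
    ∃ F : (Fin d → ℝ) → ℝ, Continuous F ∧ Integrable F μ ∧
      (∃ B : ℝ, ∀ x y, |F x - F y| ≤ B + ‖x - y‖) ∧
      ∫⁻ x, ENNReal.ofReal (exp (F x)) ≤ ENNReal.ofReal (1 + ε) ∧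
      ∫ x, log (μ.rnDeriv volume x).toReal ∂μ - ε ≤ ∫ x, F x ∂μ := by
  set f : (Fin d → ℝ) → ℝ := fun x => (μ.rnDeriv volume x).toReal with hf
  set g := laplaceAverage μ with hg
  have hgpos : ∀ x, 0 < g x := laplaceAverage_pos
  have hlg : Integrable (fun x => log (g x)) μ := integrable_log_laplaceAverage hH
  have hlgc : Continuous fun x => log (g x) := continuous_log_laplaceAverage
  have hgm : Measurable g := by
    have : g = fun x => exp (log (g x)) := funext fun x => (exp_log (hgpos x)).symm
    rw [this]
    exact (continuous_exp.comp hlgc).measurable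
  have hfm : Measurable f := (Measure.measurable_rnDeriv _ _).ennreal_toReal
  set γ : Measure (Fin d → ℝ) := volume.withDensity fun x => ENNReal.ofReal (g x) with hγ
  have : IsFiniteMeasure γ :=
    isFiniteMeasure_withDensity (lintegral_laplaceAverage_ne_top integrable_exp_neg_norm)
  set a : (Fin d → ℝ) → ℝ := fun x => f x / g x with ha
  have ha0 : ∀ x, 0 ≤ a x := fun x => div_nonneg ENNReal.toReal_nonneg (hgpos x).le
  have ham : Measurable a := hfm.div hgm
  have hfpos : ∀ᵐ x ∂μ, 0 < f x := by
    filter_upwards [Measure.rnDeriv_pos hac, hac.ae_le (Measure.rnDeriv_ne_top μ volume)]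
      with x h1 h2 using ENNReal.toReal_pos h1.ne' h2
  have hla : ∀ᵐ x ∂μ, log (f x) - log (g x) = log (a x) := by
    filter_upwards [hfpos] with x hx using (log_div hx.ne' (hgpos x).ne').symm
  have hlai : Integrable (fun x => log (a x)) μ := (hlog.sub hlg).congr hla
  have hlim : Tendsto (fun n : ℕ => ∫ x, clampLog n (a x) ∂μ) atTop (𝓝 (∫ x, log (a x) ∂μ)) := by
    refine tendsto_integral_of_dominated_convergence (fun x => |log (a x)|)
      (fun n => ((measurable_clampLog _).comp ham).aestronglyMeasurable) hlai.abs (fun n => ?_) ?_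
    · filter_upwards [hfpos] with x hx
      exact abs_clampLog_le n.cast_nonneg (div_pos hx (hgpos x))
    · filter_upwards [hfpos] with x hx
      exact tendsto_clampLog (div_pos hx (hgpos x))
  have hlim0 : Tendsto (fun n : ℕ => exp (-(n : ℝ)) * γ.real Set.univ) atTop (𝓝 0) := by
    simpa using ((tendsto_exp_neg_atTop_nhds_zero.comp tendsto_natCast_atTop_atTop).mul_const
      (γ.real Set.univ))
  obtain ⟨n, hn1, hn2⟩ := ((hlim.eventually (lt_mem_nhds (sub_lt_self _ (half_pos hε)))).and
    (hlim0.eventually (gt_mem_nhds (half_pos hε)))).exists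
  have hn0 : (0 : ℝ) ≤ n := n.cast_nonneg
  set u : (Fin d → ℝ) → ℝ := fun x => clampLog n (a x) with hu
  have hum : Measurable u := (measurable_clampLog _).comp ham
  have huI : ∀ x, u x ∈ Set.Icc (-(n : ℝ)) n := fun x => clampLog_mem_Icc hn0 _
  have hbdd : ∀ (w : (Fin d → ℝ) → ℝ), Measurable w → (∀ x, w x ∈ Set.Icc (-(n : ℝ)) n) →
      ∀ m : Measure (Fin d → ℝ), IsFiniteMeasure m → Integrable w m := fun w hw hwI m hm =>
    (integrable_const (n : ℝ)).mono' hw.aestronglyMeasurable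
      (.of_forall fun x => abs_le.2 (hwI x))
  have hδ : 0 < ε / 2 * exp (-(n : ℝ)) := by positivity
  obtain ⟨v₀, hv₀, hv₀i⟩ :=
    (hbdd u hum huI (μ + γ) inferInstance).exists_boundedContinuous_integral_sub_le hδ
  set v : (Fin d → ℝ) → ℝ := fun x => max (-(n : ℝ)) (min (n : ℝ) (v₀ x)) with hv
  have hvc : Continuous v := by fun_prop
  have hvI : ∀ x, v x ∈ Set.Icc (-(n : ℝ)) n := fun x =>
    ⟨le_max_left _ _, max_le (by linarith) (min_le_left _ _)⟩
  have huv : ∀ x, |u x - v x| ≤ ‖u x - v₀ x‖ := fun x => by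
    have h1 : u x = max (-(n : ℝ)) (min n (u x)) := by
      rw [min_eq_right (huI x).2, max_eq_right (huI x).1]
    rw [h1]
    calc _ ≤ |min (n : ℝ) (u x) - min (n : ℝ) (v₀ x)| := by
            simpa using abs_max_sub_max_le_max (-(n : ℝ)) (min n (u x)) (-(n : ℝ)) (min (n : ℝ) (v₀ x))
      _ ≤ |u x - v₀ x| := by
            simpa using abs_min_sub_min_le_max (n : ℝ) (u x) (n : ℝ) (v₀ x)
      _ = _ := by rw [← h1, Real.norm_eq_abs]
  have hvi := hbdd v hvc.measurable hvI
  have hui := hbdd u hum huI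
  have huvi : ∀ m : Measure (Fin d → ℝ), IsFiniteMeasure m →
      Integrable (fun x => |u x - v x|) m := fun m hm => ((hui m hm).sub (hvi m hm)).abs
  have hsum : ∫ x, |u x - v x| ∂μ + ∫ x, |u x - v x| ∂γ ≤ ε / 2 * exp (-(n : ℝ)) := by
    rw [← integral_add_measure (huvi μ inferInstance) (huvi γ inferInstance)]
    exact (integral_mono (huvi _ inferInstance) ((hui _ inferInstance).sub hv₀i).norm huv).trans hv₀
  have hμuv0 : 0 ≤ ∫ x, |u x - v x| ∂μ := integral_nonneg fun _ => abs_nonneg _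
  have hγuv0 : 0 ≤ ∫ x, |u x - v x| ∂γ := integral_nonneg fun _ => abs_nonneg _
  refine ⟨fun x => v x + log (g x), hvc.add hlgc, (hvi μ inferInstance).add hlg,
    ⟨2 * n, fun x y => ?_⟩, ?_, ?_⟩
  · have h1 := abs_log_laplaceAverage_sub_le (μ := μ) x y
    have h2 : |v x - v y| ≤ 2 * n := by
      rw [abs_le]
      constructor <;> linarith [(hvI x).1, (hvI x).2, (hvI y).1, (hvI y).2]
    calc |v x + log (g x) - (v y + log (g y))| = |(v x - v y) + (log (g x) - log (g y))| := by
          ring_nf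
      _ ≤ _ := (abs_add_le _ _).trans (add_le_add h2 h1)
  · have hae : ∫⁻ x, ENNReal.ofReal (a x) ∂γ ≤ 1 := by
      rw [hγ, lintegral_withDensity_eq_lintegral_mul _ hgm.ennreal_ofReal ham.ennreal_ofReal]
      calc _ ≤ ∫⁻ x, μ.rnDeriv volume x := lintegral_mono fun x => by
            rw [Pi.mul_apply, ← ENNReal.ofReal_mul (hgpos x).le, ha]
            simp only
            rw [mul_div_cancel₀ _ (hgpos x).ne']
            exact ENNReal.ofReal_toReal_le
        _ ≤ μ Set.univ := Measure.lintegral_rnDeriv_le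
        _ = 1 := measure_univ
    have hexp : ∫⁻ x, ENNReal.ofReal (exp (v x + log (g x)))
        = ∫⁻ x, ENNReal.ofReal (exp (v x)) ∂γ := by
      rw [hγ, lintegral_withDensity_eq_lintegral_mul _ hgm.ennreal_ofReal
        (by fun_prop : Measurable fun x => ENNReal.ofReal (exp (v x)))]
      refine lintegral_congr fun x => ?_
      rw [Pi.mul_apply, ← ENNReal.ofReal_mul (hgpos x).le, exp_add, exp_log (hgpos x), mul_comm]
    have hint : Integrable (fun x => exp (-(n : ℝ)) + exp n * |u x - v x|) γ :=
      (integrable_const _).add ((huvi γ inferInstance).const_mul _)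
    rw [hexp]
    calc ∫⁻ x, ENNReal.ofReal (exp (v x)) ∂γ
        ≤ ∫⁻ x, (ENNReal.ofReal (a x)
          + ENNReal.ofReal (exp (-(n : ℝ)) + exp n * |u x - v x|)) ∂γ :=
        lintegral_mono fun x => by
          rw [← ENNReal.ofReal_add (ha0 x) (by positivity)]
          refine ENNReal.ofReal_le_ofReal ?_
          have h1 := exp_le_exp_add_of_le (u x) (hvI x).2
          have h2 := exp_clampLog_le n (ha0 x)
          simp only [hu] at h1 h2 ⊢
          linarith
      _ = ∫⁻ x, ENNReal.ofReal (a x) ∂γ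
          + ENNReal.ofReal (∫ x, (exp (-(n : ℝ)) + exp n * |u x - v x|) ∂γ) := by
        rw [lintegral_add_left ham.ennreal_ofReal, ofReal_integral_eq_lintegral_ofReal hint
          (.of_forall fun x => by positivity)]
      _ ≤ 1 + ENNReal.ofReal ε := by
        refine add_le_add hae (ENNReal.ofReal_le_ofReal ?_)
        rw [integral_add (integrable_const _) ((huvi γ inferInstance).const_mul _),
          integral_const, integral_const_mul, smul_eq_mul, mul_comm]
        have h1 : exp (n : ℝ) * ∫ x, |u x - v x| ∂γ ≤ exp n * (ε / 2 * exp (-(n : ℝ))) :=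
          mul_le_mul_of_nonneg_left (by linarith) (exp_pos _).le
        have h2 : exp (n : ℝ) * (ε / 2 * exp (-(n : ℝ))) = ε / 2 := by
          rw [mul_left_comm, ← exp_add]
          simp
        linarith
      _ = ENNReal.ofReal (1 + ε) := by
        rw [ENNReal.ofReal_add zero_le_one hε.le, ENNReal.ofReal_one]
  · rw [integral_add (hvi μ inferInstance) hlg]
    have h1 : ∫ x, log (a x) ∂μ = ∫ x, log (f x) ∂μ - ∫ x, log (g x) ∂μ := by
      rw [← integral_sub hlog hlg]
      exact (integral_congr_ae hla).symm
    have h2 : ∫ x, u x ∂μ - ∫ x, v x ∂μ ≤ ∫ x, |u x - v x| ∂μ := by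
      rw [← integral_sub (hui μ inferInstance) (hvi μ inferInstance)]
      exact integral_mono ((hui μ inferInstance).sub (hvi μ inferInstance))
        (huvi μ inferInstance) fun x => le_abs_self _
    have h3 : ε / 2 * exp (-(n : ℝ)) ≤ ε / 2 :=
      mul_le_of_le_one_right (by positivity) (exp_le_one_iff.2 (by linarith))
    linarith

end ContinuousApproximation

section ScaledKernel

variable {d : ℕ} {r : ℝ} {ν : Seminorm ℝ (Fin d → ℝ)}

/-- The probability density proportional to `exp (-(ν x / t) ^ r)`. -/
noncomputable def expPowerDensity (ν : Seminorm ℝ (Fin d → ℝ)) (r t : ℝ) (x : Fin d → ℝ) : ℝ :=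
  exp (-((ν x) ^ r / t ^ r)) / ((∫ y, exp (-(ν y) ^ r)) * t ^ d)

/-- The measure with density `expPowerDensity ν r t`. -/
noncomputable def expPowerMeasure (ν : Seminorm ℝ (Fin d → ℝ)) (r t : ℝ) : Measure (Fin d → ℝ) :=
  volume.withDensity fun x => ENNReal.ofReal (expPowerDensity ν r t x)

lemma measurable_expPowerDensity (hνcont : Continuous fun x => ν x) (t : ℝ) :
    Measurable (expPowerDensity ν r t) := by
  have := hνcont.measurable
  unfold expPowerDensity
  fun_prop

variable (hr : 0 < r) (hνdef : ∀ x, ν x = 0 → x = 0) (hνcont : Continuous fun x => ν x)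
include hr hνdef hνcont

lemma expPowerDensity_pos {t : ℝ} (ht : 0 < t) (x : Fin d → ℝ) : 0 < expPowerDensity ν r t x :=
  div_pos (exp_pos _)
    (mul_pos (integral_exp_neg_seminorm_rpow_pos hr hνdef hνcont) (pow_pos ht d))

lemma expPowerDensity_le {t : ℝ} (ht : 0 < t) (x : Fin d → ℝ) :
    expPowerDensity ν r t x ≤ 1 / ((∫ y, exp (-(ν y) ^ r)) * t ^ d) := by
  have hZ := integral_exp_neg_seminorm_rpow_pos hr hνdef hνcont
  unfold expPowerDensity
  gcongr
  rw [exp_le_one_iff, neg_nonpos]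
  exact div_nonneg (rpow_nonneg (apply_nonneg ν x) r) (rpow_nonneg ht.le r)

lemma log_expPowerDensity {t : ℝ} (ht : 0 < t) (x : Fin d → ℝ) :
    log (expPowerDensity ν r t x)
      = -((ν x) ^ r / t ^ r) - (log (∫ y, exp (-(ν y) ^ r)) + d * log t) := by
  have hZ := integral_exp_neg_seminorm_rpow_pos hr hνdef hνcont
  rw [expPowerDensity, log_div (exp_pos _).ne' (mul_pos hZ (pow_pos ht d)).ne', log_exp,
    log_mul hZ.ne' (pow_pos ht d).ne', log_pow]

omit hνdef hr in
lemma map_smul_expPowerMeasure_one {t : ℝ} (ht : 0 < t) :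
    (expPowerMeasure ν r 1).map (fun x => t • x) = expPowerMeasure ν r t := by
  have hm := measurable_expPowerDensity (r := r) hνcont
  have hsm : Measurable fun x : Fin d → ℝ => t • x := measurable_const_smul t
  have htr : (0 : ℝ) < t ^ r := rpow_pos_of_pos ht r
  have htd : (0 : ℝ) < t ^ d := pow_pos ht d
  have hscale : ∀ x, expPowerDensity ν r 1 x = t ^ d * expPowerDensity ν r t (t • x) := fun x => by
    simp only [expPowerDensity, seminorm_smul_rpow ht, one_rpow, one_pow, mul_one, div_one,
      mul_div_cancel_left₀ _ htr.ne']
    field_simp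
  ext S hS
  rw [Measure.map_apply hsm hS, expPowerMeasure, expPowerMeasure,
    withDensity_apply _ (hsm hS), withDensity_apply _ hS]
  have h := setLIntegral_map (μ := volume) hS
    (f := fun x => ENNReal.ofReal (t ^ d * expPowerDensity ν r t x))
    ((hm t).const_mul _).ennreal_ofReal hsm
  simp only [hscale]
  rw [← h, Measure.map_addHaar_smul _ ht.ne', Measure.restrict_smul, lintegral_smul_measure]
  simp only [Module.finrank_fin_fun, ENNReal.ofReal_mul htd.le]
  rw [lintegral_const_mul _ (hm t).ennreal_ofReal, smul_eq_mul, ← mul_assoc,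
    ← ENNReal.ofReal_mul (abs_nonneg _), abs_of_pos (inv_pos.2 htd), inv_mul_cancel₀ htd.ne',
    ENNReal.ofReal_one, one_mul]

lemma integrable_expPowerMeasure_one_iff {G : (Fin d → ℝ) → ℝ} :
    Integrable G (expPowerMeasure ν r 1)
      ↔ Integrable (fun x => G x * exp (-(ν x) ^ r)) volume := by
  have hZ := integral_exp_neg_seminorm_rpow_pos hr hνdef hνcont
  rw [expPowerMeasure, integrable_withDensity_iff_integrable_smul'
    (measurable_expPowerDensity hνcont 1).ennreal_ofReal (.of_forall fun _ => ENNReal.ofReal_lt_top),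
    ← integrable_const_mul_iff (inv_pos.2 hZ).ne'.isUnit fun x => G x * exp (-(ν x) ^ r)]
  refine iff_of_eq (congrArg (Integrable · _) (funext fun x => ?_))
  rw [ENNReal.toReal_ofReal (expPowerDensity_pos hr hνdef hνcont one_pos x).le, expPowerDensity]
  simp only [one_rpow, one_pow, mul_one, div_one, smul_eq_mul]
  ring

lemma integral_expPowerMeasure_one (G : (Fin d → ℝ) → ℝ) :
    ∫ x, G x ∂expPowerMeasure ν r 1
      = (∫ x, G x * exp (-(ν x) ^ r)) / ∫ y, exp (-(ν y) ^ r) := by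
  rw [expPowerMeasure, integral_withDensity_eq_integral_toReal_smul
    (measurable_expPowerDensity hνcont 1).ennreal_ofReal (.of_forall fun _ => ENNReal.ofReal_lt_top),
    ← integral_div]
  refine integral_congr_ae (.of_forall fun x => ?_)
  simp only
  rw [ENNReal.toReal_ofReal (expPowerDensity_pos hr hνdef hνcont one_pos x).le, expPowerDensity]
  simp only [one_rpow, one_pow, mul_one, div_one, smul_eq_mul]
  ring

lemma isProbabilityMeasure_expPowerMeasure {t : ℝ} (ht : 0 < t) :
    IsProbabilityMeasure (expPowerMeasure ν r t) := by
  have hZ := integral_exp_neg_seminorm_rpow_pos hr hνdef hνcont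
  have : IsProbabilityMeasure (expPowerMeasure ν r 1) := by
    have h1 : Integrable (fun _ => (1 : ℝ)) (expPowerMeasure ν r 1) := by
      rw [integrable_expPowerMeasure_one_iff hr hνdef hνcont]
      simpa using integrable_exp_neg_seminorm_rpow hr hνdef hνcont
    have : IsFiniteMeasure (expPowerMeasure ν r 1) := by
      simpa [integrable_const_iff] using h1
    have h2 := integral_expPowerMeasure_one hr hνdef hνcont fun _ => 1
    simp only [one_mul, div_self hZ.ne', integral_const, smul_eq_mul, mul_one] at h2
    exact ⟨(ENNReal.toReal_eq_one_iff _).1 h2⟩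
  rw [← map_smul_expPowerMeasure_one hνcont ht]
  exact Measure.isProbabilityMeasure_map (measurable_const_smul t).aemeasurable

lemma integrable_norm_expPowerMeasure_one :
    Integrable (fun x => ‖x‖) (expPowerMeasure ν r 1) :=
  (integrable_expPowerMeasure_one_iff hr hνdef hνcont).2
    (integrable_norm_mul_exp_neg_seminorm_rpow hr hνdef hνcont)

lemma integrable_seminorm_rpow_expPowerMeasure {t : ℝ} (ht : 0 < t) :
    Integrable (fun x => (ν x) ^ r) (expPowerMeasure ν r t) := by
  have hm : Measurable fun x => (ν x) ^ r := hνcont.measurable.pow_const r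
  rw [← map_smul_expPowerMeasure_one hνcont ht,
    integrable_map_measure hm.aestronglyMeasurable (measurable_const_smul t).aemeasurable]
  simp only [Function.comp_def, seminorm_smul_rpow ht]
  exact ((integrable_expPowerMeasure_one_iff hr hνdef hνcont).2
    (integrable_seminorm_rpow_mul_exp_neg hr hνdef hνcont)).const_mul _

lemma integral_seminorm_rpow_expPowerMeasure {t : ℝ} (ht : 0 < t) :
    ∫ x, (ν x) ^ r ∂expPowerMeasure ν r t = d / r * t ^ r := by
  have hZ := integral_exp_neg_seminorm_rpow_pos hr hνdef hνcont
  have hm : Measurable fun x => (ν x) ^ r := hνcont.measurable.pow_const r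
  rw [← map_smul_expPowerMeasure_one hνcont ht,
    integral_map (measurable_const_smul t).aemeasurable hm.aestronglyMeasurable]
  simp only [seminorm_smul_rpow ht]
  rw [integral_const_mul, integral_expPowerMeasure_one hr hνdef hνcont,
    integral_seminorm_rpow_mul_exp_neg hr hνdef hνcont, mul_div_cancel_right₀ _ hZ.ne', mul_comm]

lemma integrable_log_expPowerDensity {t : ℝ} (ht : 0 < t) :
    Integrable (fun x => log (expPowerDensity ν r t x)) (expPowerMeasure ν r t) := by
  have := isProbabilityMeasure_expPowerMeasure hr hνdef hνcont ht
  simp only [log_expPowerDensity hr hνdef hνcont ht]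
  exact ((integrable_seminorm_rpow_expPowerMeasure hr hνdef hνcont ht).div_const _).neg.sub
    (integrable_const _)

lemma integral_log_expPowerDensity {t : ℝ} (ht : 0 < t) :
    ∫ x, log (expPowerDensity ν r t x) ∂expPowerMeasure ν r t
      = -(d / r) - (log (∫ y, exp (-(ν y) ^ r)) + d * log t) := by
  have := isProbabilityMeasure_expPowerMeasure hr hνdef hνcont ht
  have hi : Integrable (fun x => -((ν x) ^ r / t ^ r)) (expPowerMeasure ν r t) :=
    ((integrable_seminorm_rpow_expPowerMeasure hr hνdef hνcont ht).div_const _).neg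
  simp only [log_expPowerDensity hr hνdef hνcont ht]
  rw [integral_sub hi (integrable_const _), integral_neg, integral_div,
    integral_seminorm_rpow_expPowerMeasure hr hνdef hνcont ht,
    mul_div_cancel_right₀ _ (rpow_pos_of_pos ht r).ne', integral_const]
  simp

end ScaledKernel

section RateDistortion

variable {d : ℕ} {r : ℝ} {ν : Seminorm ℝ (Fin d → ℝ)} {μ : Measure (Fin d → ℝ)}
  [IsProbabilityMeasure μ]

/-- The Shannon lower bound, parametrised by the scale `t` with `D = (d / r) * t ^ r`. -/
lemma shannon_lower_bound (hr : 0 < r) (hνdef : ∀ x, ν x = 0 → x = 0)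
    (hνcont : Continuous fun x => ν x) (hac : μ ≪ volume)
    (hlog : Integrable (fun x => log (μ.rnDeriv volume x).toReal) μ) {t : ℝ} (ht : 0 < t)
    {κ : Measure ((Fin d → ℝ) × (Fin d → ℝ))} [IsProbabilityMeasure κ]
    (hfst : κ.map Prod.fst = μ)
    (hD : ∫⁻ p, ENNReal.ofReal (ν (p.1 - p.2) ^ r) ∂κ ≤ ENNReal.ofReal (d / r * t ^ r)) :
    ENNReal.ofReal (-∫ x, log (μ.rnDeriv volume x).toReal ∂μ - d / r
        - (log (∫ y, exp (-(ν y) ^ r)) + d * log t))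
      ≤ klDiv κ ((κ.map Prod.fst).prod (κ.map Prod.snd)) := by
  have hρ : IsProbabilityMeasure (κ.map Prod.snd) :=
    Measure.isProbabilityMeasure_map measurable_snd.aemeasurable
  rw [hfst, klDiv]
  split_ifs with h
  swap
  · exact le_top
  have hm : Measurable fun p : (Fin d → ℝ) × (Fin d → ℝ) => ν (p.1 - p.2) ^ r :=
    (hνcont.measurable.comp (measurable_fst.sub measurable_snd)).pow_const r
  have hn : ∀ p : (Fin d → ℝ) × (Fin d → ℝ), 0 ≤ ν (p.1 - p.2) ^ r := fun p =>
    rpow_nonneg (apply_nonneg _ _) r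
  have htr : (0 : ℝ) < t ^ r := rpow_pos_of_pos ht r
  have hi : Integrable (fun p : (Fin d → ℝ) × (Fin d → ℝ) => ν (p.1 - p.2) ^ r) κ :=
    (lintegral_ofReal_ne_top_iff_integrable hm.aestronglyMeasurable (.of_forall hn)).1
      (hD.trans_lt ENNReal.ofReal_lt_top).ne
  have hle : ∫ p, ν (p.1 - p.2) ^ r ∂κ ≤ d / r * t ^ r := by
    rw [← ofReal_integral_eq_lintegral_ofReal hi (.of_forall hn)] at hD
    exact (ENNReal.ofReal_le_ofReal_iff (by positivity)).1 hD
  have hi' : Integrable (fun p : (Fin d → ℝ) × (Fin d → ℝ) => -(ν (p.1 - p.2) ^ r / t ^ r)) κ :=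
    (hi.div_const _).neg
  have hq1 : ∫⁻ x, ENNReal.ofReal (expPowerDensity ν r t x) ≤ 1 := by
    have := (isProbabilityMeasure_expPowerMeasure hr hνdef hνcont ht).measure_univ
    rw [expPowerMeasure, withDensity_apply _ .univ, Measure.restrict_univ] at this
    exact this.le
  have key := neg_integral_log_rnDeriv_add_le_integral_llr hfst hac h.1 h.2 hlog
    (measurable_expPowerDensity (r := r) hνcont t) (expPowerDensity_pos hr hνdef hνcont ht) hq1
    (by
      simp only [log_expPowerDensity hr hνdef hνcont ht]
      exact hi'.sub (integrable_const _))
  simp only [log_expPowerDensity hr hνdef hνcont ht] at key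
  rw [integral_sub hi' (integrable_const _), integral_neg, integral_div, integral_const] at key
  have hle' : (∫ p, ν (p.1 - p.2) ^ r ∂κ) / t ^ r ≤ d / r := (div_le_iff₀ htr).2 hle
  refine ENNReal.ofReal_le_ofReal (le_trans ?_ key)
  simp only [probReal_univ, one_smul]
  linarith

lemma lintegral_seminorm_rpow_map_prod_add (hr : 0 < r) (hνdef : ∀ x, ν x = 0 → x = 0)
    (hνcont : Continuous fun x => ν x) {t : ℝ} (ht : 0 < t) :
    ∫⁻ p, ENNReal.ofReal (ν (p.1 - p.2) ^ r)
        ∂((μ.prod (expPowerMeasure ν r t)).map fun p => (p.1, p.1 + p.2))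
      = ENNReal.ofReal (d / r * t ^ r) := by
  have := isProbabilityMeasure_expPowerMeasure hr hνdef hνcont ht
  have hm : Measurable fun x => ENNReal.ofReal (ν x ^ r) :=
    (hνcont.measurable.pow_const r).ennreal_ofReal
  rw [lintegral_map
    (f := fun p : (Fin d → ℝ) × (Fin d → ℝ) => ENNReal.ofReal (ν (p.1 - p.2) ^ r))
    (hm.comp (measurable_fst.sub measurable_snd)) (by fun_prop)]
  simp only [sub_add_cancel_left, map_neg_eq_map]
  rw [measurePreserving_snd.lintegral_comp hm,
    ← integral_seminorm_rpow_expPowerMeasure hr hνdef hνcont ht,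
    ofReal_integral_eq_lintegral_ofReal
      (integrable_seminorm_rpow_expPowerMeasure hr hνdef hνcont ht)
      (.of_forall fun x => rpow_nonneg (apply_nonneg _ _) r)]

section Perturbation

variable (hr : 0 < r) (hνdef : ∀ x, ν x = 0 → x = 0) (hνcont : Continuous fun x => ν x)
  {F : (Fin d → ℝ) → ℝ} (hFc : Continuous F) (hF : Integrable F μ)
  {B : ℝ} (hB : ∀ x y, |F x - F y| ≤ B + ‖x - y‖)
include hr hνdef hνcont hF hB

omit [IsProbabilityMeasure μ] hr hνdef hνcont hF in
lemma norm_add_smul_le {t : ℝ} (ht : 0 < t) (p : (Fin d → ℝ) × (Fin d → ℝ)) :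
    ‖F (p.1 + t • p.2)‖ ≤ ‖F p.1‖ + (B + t * ‖p.2‖) := by
  have h := hB (p.1 + t • p.2) p.1
  rw [add_sub_cancel_left, norm_smul, Real.norm_of_nonneg ht.le] at h
  have h2 := norm_add_le (F p.1) (F (p.1 + t • p.2) - F p.1)
  rw [add_sub_cancel] at h2
  exact h2.trans (add_le_add le_rfl h)

omit hB in
lemma integrable_norm_add_mul_norm (B t : ℝ) :
    Integrable (fun p : (Fin d → ℝ) × (Fin d → ℝ) => ‖F p.1‖ + (B + t * ‖p.2‖))
      (μ.prod (expPowerMeasure ν r 1)) := by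
  have := isProbabilityMeasure_expPowerMeasure hr hνdef hνcont one_pos
  exact (hF.norm.comp_fst _).add ((integrable_const _).add
    (((integrable_norm_expPowerMeasure_one hr hνdef hνcont).comp_snd _).const_mul t))

omit hF hB in
lemma map_prod_smul_expPowerMeasure_one {t : ℝ} (ht : 0 < t) :
    (μ.prod (expPowerMeasure ν r 1)).map (fun p => (p.1, t • p.2))
      = μ.prod (expPowerMeasure ν r t) := by
  have := isProbabilityMeasure_expPowerMeasure hr hνdef hνcont one_pos
  rw [← map_smul_expPowerMeasure_one hνcont ht]
  conv_rhs => rw [← Measure.map_id (μ := μ),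
    Measure.map_prod_map _ _ measurable_id (measurable_const_smul t)]
  rfl

include hFc

lemma integrable_comp_add {t : ℝ} (ht : 0 < t) :
    Integrable (fun p => F (p.1 + p.2)) (μ.prod (expPowerMeasure ν r t)) := by
  have hm : Continuous fun p : (Fin d → ℝ) × (Fin d → ℝ) => F (p.1 + p.2) := by fun_prop
  rw [← map_prod_smul_expPowerMeasure_one hr hνdef hνcont ht,
    integrable_map_measure hm.aestronglyMeasurable (by fun_prop)]
  exact (integrable_norm_add_mul_norm hr hνdef hνcont hF B t).mono'
    (by fun_prop : Continuous _).aestronglyMeasurable (.of_forall (norm_add_smul_le hB ht))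

lemma tendsto_integral_comp_add :
    Tendsto (fun t => ∫ p, F (p.1 + p.2) ∂(μ.prod (expPowerMeasure ν r t))) (𝓝[>] 0)
      (𝓝 (∫ x, F x ∂μ)) := by
  have := isProbabilityMeasure_expPowerMeasure hr hνdef hνcont one_pos
  have hm : Continuous fun p : (Fin d → ℝ) × (Fin d → ℝ) => F (p.1 + p.2) := by fun_prop
  have h0 : ∫ x, F x ∂μ = ∫ p, F p.1 ∂(μ.prod (expPowerMeasure ν r 1)) := by
    rw [integral_fun_fst]
    simp
  rw [h0]
  refine Tendsto.congr' (f₁ := fun t => ∫ p, F (p.1 + t • p.2) ∂(μ.prod (expPowerMeasure ν r 1)))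
    ?_ ?_
  · filter_upwards [self_mem_nhdsWithin] with t ht
    rw [← map_prod_smul_expPowerMeasure_one hr hνdef hνcont (Set.mem_Ioi.1 ht),
      integral_map (by fun_prop) hm.aestronglyMeasurable]
  · refine tendsto_integral_filter_of_dominated_convergence _ ?_ ?_
      (integrable_norm_add_mul_norm hr hνdef hνcont hF B 1) ?_
    · exact .of_forall fun t => (by fun_prop : Continuous _).aestronglyMeasurable
    · filter_upwards [Ioc_mem_nhdsGT one_pos] with t ht
      refine .of_forall fun p => (norm_add_smul_le hB ht.1 p).trans ?_
      gcongr
      exact ht.2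
    · refine .of_forall fun p => ?_
      have : Continuous fun t : ℝ => F (p.1 + t • p.2) := by fun_prop
      simpa using (this.tendsto 0).mono_left nhdsWithin_le_nhds

end Perturbation

/-- Adding independent noise with law `expPowerMeasure ν r t` nearly attains the Shannon lower
bound as `t → 0`. -/
lemma eventually_exists_klDiv_le (hr : 0 < r) (hνdef : ∀ x, ν x = 0 → x = 0)
    (hνcont : Continuous fun x => ν x) (hac : μ ≪ volume)
    (hlog : Integrable (fun x => log (μ.rnDeriv volume x).toReal) μ)
    (hH : discEnt μ (intFloor d) ≠ ⊤) {ε : ℝ} (hε : 0 < ε) :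
    ∀ᶠ t in 𝓝[>] (0 : ℝ), ∃ κ : Measure ((Fin d → ℝ) × (Fin d → ℝ)),
      IsProbabilityMeasure κ ∧ κ.map Prod.fst = μ ∧
      ∫⁻ p, ENNReal.ofReal (ν (p.1 - p.2) ^ r) ∂κ ≤ ENNReal.ofReal (d / r * t ^ r) ∧
      klDiv κ ((κ.map Prod.fst).prod (κ.map Prod.snd))
        ≤ ENNReal.ofReal (-∫ x, log (μ.rnDeriv volume x).toReal ∂μ - d / r
          - (log (∫ y, exp (-(ν y) ^ r)) + d * log t) + ε) := by
  obtain ⟨F, hFc, hF, ⟨B, hB⟩, hF1, hFle⟩ :=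
    exists_continuous_approx_log_rnDeriv hac hlog hH (ε := ε / 3) (by positivity)
  filter_upwards [self_mem_nhdsWithin, (tendsto_integral_comp_add hr hνdef hνcont hFc hF hB).eventually
    (lt_mem_nhds (sub_lt_self _ (by positivity : 0 < ε / 3)))] with t ht hlt
  replace ht : 0 < t := ht
  have := isProbabilityMeasure_expPowerMeasure hr hνdef hνcont ht
  have hT : Measurable fun p : (Fin d → ℝ) × (Fin d → ℝ) => (p.1, p.1 + p.2) := by fun_prop
  refine ⟨(μ.prod (expPowerMeasure ν r t)).map fun p => (p.1, p.1 + p.2),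
    Measure.isProbabilityMeasure_map hT.aemeasurable, ?_,
    (lintegral_seminorm_rpow_map_prod_add hr hνdef hνcont ht).le, ?_⟩
  · rw [Measure.map_map measurable_fst hT]
    exact measurePreserving_fst.map_eq
  · refine (klDiv_map_prod_add_le (ρ := expPowerMeasure ν r t)
      (measurable_expPowerDensity hνcont t)
      (expPowerDensity_pos hr hνdef hνcont ht) (expPowerDensity_le hr hνdef hνcont ht) rfl
      (integrable_log_expPowerDensity hr hνdef hνcont ht) hFc.measurable
      (integrable_comp_add hr hνdef hνcont hFc hF hB ht) (by positivity) hF1 rfl).trans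
      (ENNReal.ofReal_le_ofReal ?_)
    rw [integral_log_expPowerDensity hr hνdef hνcont ht]
    linarith

end RateDistortion

/-- **Asymptotic tightness of the Shannon lower bound** (Theorem 2, direct part).
If the d-dimensional source `X` has a pdf, finite differential entropy, and
`H(⌊X⌋) < ∞`, then `R(D) − R_SLB(D) → 0` as `D ↓ 0` (in particular `R(D)` is
eventually finite). -/
theorem shannon_lower_bound_asymptotically_tight
    {Ω : Type*} [MeasurableSpace Ω] (P : Measure Ω) [IsProbabilityMeasure P]
    (d : ℕ) (hd : 1 ≤ d) (r : ℝ) (hr : 0 < r)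
    (ν : Seminorm ℝ (Fin d → ℝ)) (hνdef : ∀ x, ν x = 0 → x = 0)
    (hνcont : Continuous fun x => ν x)
    (X : Ω → (Fin d → ℝ)) (hX : Measurable X)
    (hac : Measure.map X P ≪ volume)
    (hent : Integrable (fun x =>
      (((Measure.map X P).rnDeriv volume x).toReal) *
        Real.log (((Measure.map X P).rnDeriv volume x).toReal)) volume)
    (hH : discEnt P (fun ω => intFloor d (X ω)) ≠ ⊤) :
    -- `Vd`: volume of the unit ball of the norm `ν`
    ∀ Vd : ℝ, Vd = (volume {x : Fin d → ℝ | ν x ≤ 1}).toReal →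
    -- `R D`: the rate-distortion function at distortion `D`
    ∀ R : ℝ → ℝ≥0∞, (∀ D : ℝ, R D =
      ⨅ (μπ : Measure ((Fin d → ℝ) × (Fin d → ℝ))) (_ : IsProbabilityMeasure μπ)
        (_ : μπ.map Prod.fst = Measure.map X P)
        (_ : ∫⁻ p, ENNReal.ofReal (ν (p.1 - p.2) ^ r) ∂μπ ≤ ENNReal.ofReal D),
        klDiv μπ ((μπ.map Prod.fst).prod (μπ.map Prod.snd))) →
    -- `RSLB D`: the Shannon lower bound at distortion `D`
    ∀ RSLB : ℝ → ℝ, (∀ D : ℝ, RSLB D =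
      diffEnt (Measure.map X P) + ((d : ℝ) / r) * Real.log (1 / D)
        - ((d : ℝ) / r) *
          Real.log ((r / (d : ℝ)) * (Vd * Real.Gamma (1 + (d : ℝ) / r)) ^ (r / (d : ℝ))
            * Real.exp 1)) →
    (∀ᶠ D in 𝓝[>] (0 : ℝ), R D ≠ ⊤) ∧
      Tendsto (fun D => (R D).toReal - RSLB D) (𝓝[>] (0 : ℝ)) (𝓝 0) := by
  intro Vd hVd R hR RSLB hRSLB
  set μ := Measure.map X P with hμ
  have : IsProbabilityMeasure μ := Measure.isProbabilityMeasure_map hX.aemeasurable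
  have hHμ : discEnt μ (intFloor d) ≠ ⊤ := by
    have : discEnt μ (intFloor d) = discEnt P (fun ω => intFloor d (X ω)) :=
      tsum_congr fun i => by
        rw [hμ, Measure.map_apply hX (measurable_intFloor (measurableSet_singleton i))]
        rfl
    rwa [this]
  have hlog : Integrable (fun x => log (μ.rnDeriv volume x).toReal) μ :=
    (integrable_rnDeriv_smul_iff hac).1 hent
  have hdiffEnt : diffEnt μ = -∫ x, log (μ.rnDeriv volume x).toReal ∂μ :=
    congrArg Neg.neg (integral_rnDeriv_smul hac)
  have hd0 : (0 : ℝ) < d := by exact_mod_cast hd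
  have hα : 0 < (d : ℝ) / r := div_pos hd0 hr
  set Z := ∫ x, exp (-(ν x) ^ r) with hZdef
  have hZ : 0 < Z := integral_exp_neg_seminorm_rpow_pos hr hνdef hνcont
  set t : ℝ → ℝ := fun D => (D / (d / r)) ^ r⁻¹ with ht
  have htpos : ∀ D, 0 < D → 0 < t D := fun D hD => rpow_pos_of_pos (div_pos hD hα) _
  have htD : ∀ D, 0 < D → d / r * t D ^ r = D := fun D hD => by
    rw [ht, rpow_inv_rpow (div_pos hD hα).le hr.ne', mul_div_cancel₀ _ hα.ne']
  have htlim : Tendsto t (𝓝[>] 0) (𝓝[>] 0) := by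
    refine tendsto_nhdsWithin_iff.2 ⟨?_, eventually_mem_nhdsWithin.mono htpos⟩
    have hc : ContinuousAt t 0 :=
      (continuousAt_id.div_const _).rpow_const (.inr (inv_pos.2 hr).le)
    have h0 : t 0 = 0 := by simp [ht, zero_rpow (inv_pos.2 hr).ne']
    rw [ContinuousAt, h0] at hc
    exact hc.mono_left nhdsWithin_le_nhds
  have hRSLB_eq : ∀ D, 0 < D → RSLB D
      = -∫ x, log (μ.rnDeriv volume x).toReal ∂μ - d / r - (log Z + d * log (t D)) := by
    intro D hD
    rw [hRSLB, hdiffEnt, hVd, volume_unitBall_mul_gamma hd hr hνdef,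
      log_mul (by positivity) (exp_pos 1).ne', log_mul (by positivity) (by positivity),
      log_rpow hZ, log_exp, ht, log_rpow (div_pos hD hα), log_div hD.ne' hα.ne', one_div, log_inv,
      log_div hr.ne' hd0.ne', log_div hd0.ne' hr.ne']
    field_simp
    ring
  have hlower : ∀ D, 0 < D → ENNReal.ofReal (RSLB D) ≤ R D := by
    intro D hD
    rw [hR]
    refine le_iInf fun κ => le_iInf fun hκ => le_iInf fun hfst => le_iInf fun hκD => ?_
    rw [hRSLB_eq D hD]
    refine shannon_lower_bound hr hνdef hνcont hac hlog (htpos D hD) hfst ?_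
    rwa [htD D hD]
  have hupper : ∀ ε > 0, ∀ᶠ D in 𝓝[>] (0 : ℝ), R D ≤ ENNReal.ofReal (RSLB D + ε) := by
    intro ε hε
    filter_upwards [self_mem_nhdsWithin, htlim.eventually
      (eventually_exists_klDiv_le hr hνdef hνcont hac hlog hHμ hε)] with D hD ⟨κ, hκ, hfst, hκD, hle⟩
    rw [htD D hD] at hκD
    rw [hR, hRSLB_eq D hD]
    exact (iInf₂_le_of_le κ hκ (iInf₂_le_of_le hfst hκD le_rfl)).trans hle
  have hfin : ∀ᶠ D in 𝓝[>] (0 : ℝ), R D ≠ ⊤ :=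
    (hupper 1 one_pos).mono fun D hD => (hD.trans_lt ENNReal.ofReal_lt_top).ne
  have hRSLB_nonneg : ∀ᶠ D in 𝓝[>] (0 : ℝ), 0 ≤ RSLB D := by
    have h1 : Tendsto RSLB (𝓝[>] 0) atTop := by
      have h2 : Tendsto (fun D => (-∫ x, log (μ.rnDeriv volume x).toReal ∂μ - d / r - log Z)
          + d * -log (t D)) (𝓝[>] 0) atTop :=
        tendsto_atTop_add_const_left _ _ ((tendsto_neg_atBot_atTop.comp
          (tendsto_log_nhdsGT_zero.comp htlim)).const_mul_atTop hd0)
      refine h2.congr' (eventually_mem_nhdsWithin.mono fun D hD => ?_)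
      rw [hRSLB_eq D hD]
      ring
    exact h1.eventually_ge_atTop 0
  refine ⟨hfin, Metric.tendsto_nhds.2 fun ε hε => ?_⟩
  filter_upwards [self_mem_nhdsWithin, hfin, hRSLB_nonneg, hupper (ε / 2) (half_pos hε)]
    with D hD hDfin hD0 hDle
  have h1 := (ENNReal.ofReal_le_iff_le_toReal hDfin).1 (hlower D hD)
  have h2 := ENNReal.toReal_le_of_le_ofReal (by positivity) hDle
  rw [Real.dist_eq, sub_zero, abs_lt]
  constructor <;> linarith
end

section
/- Let d ≥ 1, r > 0, D > 0, let ‖·‖ be a norm on ℝ^d with V_d the Lebesgue volume of its unit ball, and let Z_D have density f_{Z_D}(z) = (d/r)^{d/r − 1} · (V_d · Γ(d/r) · D^{d/r})^{-1} · exp( −(d/(rD))·‖z‖^r ). Then its differential entropy equals h(Z_D) = (d/r)·log D + (d/r)·log( (r/d)·(V_d·Γ(1+d/r))^{r/d}·e ). -/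
open MeasureTheory ProbabilityTheory Real Filter Topology
open scoped ENNReal

/-- A definite seminorm is the pullback of the norm of a normed space along a linear equivalence. -/
theorem Seminorm.exists_linearEquiv_norm_eq.{u} {E : Type u} [AddCommGroup E] [Module ℝ E]
    (p : Seminorm ℝ E) (hp : ∀ x, p x = 0 → x = 0) :
    ∃ (F : Type u) (_ : NormedAddCommGroup F) (_ : NormedSpace ℝ F) (L : E ≃ₗ[ℝ] F),
      ∀ x, ‖L x‖ = p x := by
  let q : AddGroupNorm E :=
    ⟨⟨p, map_zero p, map_add_le_add p, map_neg_eq_map p⟩, fun x hx ↦ hp x hx⟩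
  let hF : NormedAddCommGroup E := AddGroupNorm.toNormedAddCommGroup q
  let hS : NormedSpace ℝ E := { norm_smul_le := fun a x ↦ (map_smul_eq_mul p a x).le }
  exact ⟨E, hF, hS, LinearEquiv.refl ℝ E, fun _ ↦ rfl⟩

/-- A definite seminorm on a finite-dimensional space is the pullback of the norm of a normed space
along a continuous linear equivalence. -/
theorem Seminorm.exists_continuousLinearEquiv_norm_eq.{u} {E : Type u} [AddCommGroup E] [Module ℝ E]
    [FiniteDimensional ℝ E] [TopologicalSpace E] [IsTopologicalAddGroup E] [T2Space E]
    [ContinuousSMul ℝ E] (p : Seminorm ℝ E) (hp : ∀ x, p x = 0 → x = 0) :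
    ∃ (F : Type u) (_ : NormedAddCommGroup F) (_ : NormedSpace ℝ F) (L : E ≃L[ℝ] F),
      ∀ x, ‖L x‖ = p x := by
  obtain ⟨F, hF, hS, L, hL⟩ := p.exists_linearEquiv_norm_eq hp
  exact ⟨F, hF, hS, L.toContinuousLinearEquiv, hL⟩

/-- Polar integration of a radial function with respect to a definite seminorm. -/
theorem Seminorm.integral_comp_eq {E G : Type*} [AddCommGroup E] [Module ℝ E]
    [FiniteDimensional ℝ E] [Nontrivial E] [TopologicalSpace E] [IsTopologicalAddGroup E]
    [T2Space E] [ContinuousSMul ℝ E] [MeasurableSpace E] [BorelSpace E]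
    [NormedAddCommGroup G] [NormedSpace ℝ G] (μ : Measure E) [μ.IsAddHaarMeasure]
    (p : Seminorm ℝ E) (hp : ∀ x, p x = 0 → x = 0) (g : ℝ → G) :
    ∫ x, g (p x) ∂μ = Module.finrank ℝ E • μ.real {x | p x ≤ 1} •
      ∫ y in Set.Ioi (0 : ℝ), y ^ (Module.finrank ℝ E - 1) • g y := by
  obtain ⟨F, _, _, L, hL⟩ := p.exists_continuousLinearEquiv_norm_eq hp
  borelize F
  have : FiniteDimensional ℝ F := L.toLinearEquiv.finiteDimensional
  have : Nontrivial F := L.injective.nontrivial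
  have : (μ.map L).IsAddHaarMeasure := L.isAddHaarMeasure_map μ
  have hemb : MeasurableEmbedding L := L.toHomeomorph.measurableEmbedding
  have key := integral_fun_norm_addHaar (μ.map L) g
  rw [hemb.integral_map, measureReal_def, ← Measure.addHaar_closedBall_eq_addHaar_ball,
    hemb.map_apply, ← measureReal_def, ← L.toLinearEquiv.finrank_eq] at key
  simpa [Set.preimage, hL] using key

theorem Seminorm.measureReal_le_one_pos {E : Type*} [AddCommGroup E] [Module ℝ E]
    [FiniteDimensional ℝ E] [TopologicalSpace E] [IsTopologicalAddGroup E]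
    [T2Space E] [ContinuousSMul ℝ E] [MeasurableSpace E] [BorelSpace E]
    (μ : Measure E) [μ.IsAddHaarMeasure]
    (p : Seminorm ℝ E) (hp : ∀ x, p x = 0 → x = 0) :
    0 < μ.real {x | p x ≤ 1} := by
  obtain ⟨F, _, _, L, hL⟩ := p.exists_continuousLinearEquiv_norm_eq hp
  borelize F
  have : FiniteDimensional ℝ F := L.toLinearEquiv.finiteDimensional
  have : (μ.map L).IsAddHaarMeasure := L.isAddHaarMeasure_map μ
  have hpos : 0 < (μ.map L).real (Metric.closedBall 0 1) :=
    ENNReal.toReal_pos (Metric.measure_closedBall_pos _ _ one_pos).ne'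
      measure_closedBall_lt_top.ne
  have hemb : MeasurableEmbedding L := L.toHomeomorph.measurableEmbedding
  rw [measureReal_def, hemb.map_apply, ← measureReal_def] at hpos
  simpa [Set.preimage, hL] using hpos

/-- The radial integral behind the entropy of the density `C * exp (-b * t ^ r)`. -/
theorem integral_pow_mul_mul_log_exp_neg_mul_rpow {n : ℕ} (hn : 1 ≤ n) {r b C : ℝ} (hr : 0 < r)
    (hb : 0 < b) (hC : 0 < C) :
    ∫ y in Set.Ioi (0 : ℝ), y ^ (n - 1) *
        (C * exp (-b * y ^ r) * log (C * exp (-b * y ^ r))) =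
      C * b ^ (-((n : ℝ) / r)) * (1 / r) * Gamma (n / r) * (log C - n / r) := by
  have hn0 : (0 : ℝ) < n := by exact_mod_cast hn
  have hs₁ : (-1 : ℝ) < n - 1 := by linarith
  have hs₂ : (-1 : ℝ) < n - 1 + r := by linarith
  have hsplit : ∀ y ∈ Set.Ioi (0 : ℝ), y ^ (n - 1) *
      (C * exp (-b * y ^ r) * log (C * exp (-b * y ^ r))) =
      C * log C * (y ^ ((n : ℝ) - 1) * exp (-b * y ^ r)) -
        C * b * (y ^ ((n : ℝ) - 1 + r) * exp (-b * y ^ r)) := by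
    intro y hy
    rw [log_mul hC.ne' (exp_ne_zero _), log_exp, rpow_add hy, ← rpow_natCast y (n - 1),
      Nat.cast_sub hn, Nat.cast_one]
    ring
  rw [setIntegral_congr_fun measurableSet_Ioi hsplit,
    integral_sub ((integrableOn_rpow_mul_exp_neg_mul_rpow hs₁ hr hb).const_mul _)
      ((integrableOn_rpow_mul_exp_neg_mul_rpow hs₂ hr hb).const_mul _),
    integral_const_mul, integral_const_mul, integral_rpow_mul_exp_neg_mul_rpow hr hs₁ hb,
    integral_rpow_mul_exp_neg_mul_rpow hr hs₂ hb,
    show ((n : ℝ) - 1 + 1) / r = n / r by ring,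
    show ((n : ℝ) - 1 + r + 1) / r = n / r + 1 by field_simp; ring,
    show -((n : ℝ) - 1 + 1) / r = -(n / r) by ring,
    show -((n : ℝ) - 1 + r + 1) / r = -(n / r) - 1 by field_simp; ring,
    Gamma_add_one (by positivity), rpow_sub_one hb.ne']
  field_simp

/-- The differential entropy of the generalized-Gaussian density `f_{Z_D}` equals
`(d/r)·log D + (d/r)·log( (r/d)·(V_d·Γ(1+d/r))^{r/d}·e )`. -/
theorem fZD_differential_entropy
    (d : ℕ) (hd : 1 ≤ d) (r D : ℝ) (hr : 0 < r) (hD : 0 < D)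
    (ν : Seminorm ℝ (Fin d → ℝ)) (hνdef : ∀ x, ν x = 0 → x = 0)
    (hνcont : Continuous fun x => ν x) :
    ∀ Vd : ℝ, Vd = (volume {x : Fin d → ℝ | ν x ≤ 1}).toReal →
    ∀ f : (Fin d → ℝ) → ℝ, (∀ z, f z =
      ((d : ℝ) / r) ^ ((d : ℝ) / r - 1) *
        (Vd * Real.Gamma ((d : ℝ) / r) * D ^ ((d : ℝ) / r))⁻¹ *
        Real.exp (-((d : ℝ) / (r * D)) * ν z ^ r)) →
    -∫ z, f z * Real.log (f z) =
      ((d : ℝ) / r) * Real.log D +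
        ((d : ℝ) / r) *
          Real.log ((r / (d : ℝ)) * (Vd * Real.Gamma (1 + (d : ℝ) / r)) ^ (r / (d : ℝ))
            * Real.exp 1) := by
  rintro Vd hVd f hf
  have hd0 : (0 : ℝ) < d := by exact_mod_cast hd
  have : Nonempty (Fin d) := ⟨⟨0, hd⟩⟩
  have hV : 0 < Vd := hVd ▸ ν.measureReal_le_one_pos volume hνdef
  set a : ℝ := (d : ℝ) / r with ha
  have ha0 : 0 < a := div_pos hd0 hr
  have hG : 0 < Gamma a := Gamma_pos_of_pos ha0
  have hb : 0 < (d : ℝ) / (r * D) := by positivity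
  set C : ℝ := a ^ (a - 1) * (Vd * Gamma a * D ^ a)⁻¹ with hCdef
  have hC : 0 < C := by positivity
  clear_value C a
  have hbC : d * Vd * (C * ((d : ℝ) / (r * D)) ^ (-a) * (1 / r) * Gamma a) = 1 := by
    rw [show (d : ℝ) / (r * D) = a / D by rw [ha]; field_simp, div_rpow ha0.le hD.le,
      rpow_neg ha0.le, rpow_neg hD.le, hCdef, rpow_sub_one ha0.ne']
    have h₁ : 0 < a ^ a := by positivity
    have h₂ : 0 < D ^ a := by positivity
    have h₃ : (d : ℝ) = a * r := by rw [ha]; field_simp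
    rw [h₃]
    field_simp
  have hint : ∫ z, f z * log (f z) = log C - a := by
    simp_rw [hf]
    rw [ν.integral_comp_eq volume hνdef (fun t ↦ C * exp (-((d : ℝ) / (r * D)) * t ^ r) *
      log (C * exp (-((d : ℝ) / (r * D)) * t ^ r))), Module.finrank_fin_fun, measureReal_def,
      ← hVd]
    simp only [smul_eq_mul, nsmul_eq_mul]
    rw [integral_pow_mul_mul_log_exp_neg_mul_rpow hd hr hb hC, ← ha]
    linear_combination (log C - a) * hbC
  have hinv : r / (d : ℝ) = a⁻¹ := by rw [ha, inv_div]
  rw [hint, hinv, add_comm 1 a, Gamma_add_one ha0.ne', log_mul (by positivity) (exp_ne_zero _),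
    log_mul (by positivity) (by positivity), log_exp, log_rpow (by positivity), log_inv,
    log_mul hV.ne' (by positivity), log_mul ha0.ne' hG.ne', hCdef,
    log_mul (by positivity) (by positivity), log_inv, log_mul (by positivity) (by positivity),
    log_mul hV.ne' hG.ne', log_rpow ha0, log_rpow hD]
  field_simp
  ring
end

section
/- Let K = Σ_{m=2}^∞ 1/(m·(log m)²) (a finite positive constant), let p_m = 1/(K·m·(log m)²) for m ≥ 2, and define f_X(x) = Σ_{m=2}^∞ p_m · m · 1{m ≤ x < m + 1/m} for x ∈ ℝ. Then f_X is a probability density on ℝ, a random variable X with density f_X has infinite integer-part entropy H(⌊X⌋) = Σ_{m=2}^∞ p_m·log(1/p_m) = ∞, and finite differential entropy: h(X) = Σ_{m=2}^∞ (log K + 2·log log m)/(K·m·(log m)²) < ∞. -/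
open MeasureTheory ProbabilityTheory Real Filter Topology
open scoped ENNReal

/-- The Bertrand series `∑ 1 / (m (log m) ^ s)` with `0 < s` converges exactly when `1 < s`. -/
theorem summable_one_div_nat_mul_log_rpow {s : ℝ} (hs : 0 < s) :
    (Summable fun m : ℕ => 1 / ((m : ℝ) * Real.log m ^ s)) ↔ 1 < s := by
  rw [← summable_condensed_iff_of_eventually_nonneg]
  · have hlog : 0 < Real.log 2 ^ s := Real.rpow_pos_of_pos (Real.log_pos one_lt_two) s
    rw [← Real.summable_one_div_nat_rpow]
    refine Iff.trans (summable_congr fun k => ?_) (summable_mul_left_iff (inv_ne_zero hlog.ne'))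
    rw [Nat.cast_pow, Nat.cast_ofNat, Real.log_pow,
      Real.mul_rpow k.cast_nonneg (Real.log_nonneg one_le_two)]
    field_simp
  · exact Eventually.of_forall fun m => by
      have := Real.log_natCast_nonneg m
      simp only [Pi.zero_apply]
      positivity
  · filter_upwards [eventually_ge_atTop 2] with k hk
    have hk' : (1 : ℝ) < k := by exact_mod_cast hk
    have hlog : 0 < Real.log k := Real.log_pos hk'
    gcongr <;> simp

theorem summable_one_div_nat_mul_log_sq :
    Summable fun m : ℕ => 1 / ((m : ℝ) * Real.log m ^ 2) := by
  simpa using (summable_one_div_nat_mul_log_rpow (s := 2) two_pos).2 one_lt_two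

theorem not_summable_one_div_nat_mul_log :
    ¬ Summable fun m : ℕ => 1 / ((m : ℝ) * Real.log m) := by
  simpa using (summable_one_div_nat_mul_log_rpow (s := 1) one_pos).not.2 (lt_irrefl 1)

theorem summable_log_log_div_nat_mul_log_sq :
    Summable fun m : ℕ => Real.log (Real.log m) / ((m : ℝ) * Real.log m ^ 2) := by
  have h := ((summable_one_div_nat_mul_log_rpow (s := 3 / 2) (by norm_num)).2
    (by norm_num)).mul_left 2
  refine h.of_norm_bounded_eventually_nat ?_
  filter_upwards [eventually_ge_atTop 3] with m hm
  have hm' : (3 : ℝ) ≤ m := by exact_mod_cast hm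
  have h1 : 1 ≤ Real.log m := by
    rw [Real.le_log_iff_exp_le (by linarith)]
    linarith [Real.exp_one_lt_d9]
  have h0 : 0 < Real.log m := by linarith
  rw [Real.norm_of_nonneg (div_nonneg (Real.log_nonneg h1) (by positivity))]
  have h2 := Real.log_le_rpow_div h0.le (ε := 1 / 2) (by norm_num)
  have h3 : Real.log m ^ (1 / 2 : ℝ) * Real.log m ^ (3 / 2 : ℝ) = Real.log m ^ 2 := by
    rw [← Real.rpow_add h0, ← Real.rpow_natCast]
    norm_num
  rw [← h3]
  have h4 : 0 < Real.log m ^ (1 / 2 : ℝ) := Real.rpow_pos_of_pos h0 _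
  have h5 : 0 < Real.log m ^ (3 / 2 : ℝ) := Real.rpow_pos_of_pos h0 _
  rw [mul_one_div, div_le_div_iff₀ (by positivity) (by positivity)]
  have h6 : Real.log (Real.log m) ≤ 2 * Real.log m ^ (1 / 2 : ℝ) := by linarith
  calc Real.log (Real.log m) * (m * Real.log m ^ (3 / 2 : ℝ))
      ≤ 2 * Real.log m ^ (1 / 2 : ℝ) * (m * Real.log m ^ (3 / 2 : ℝ)) := by gcongr
    _ = _ := by ring

/-- The interval of length `1 / m` starting at the natural number `m`. -/
def strip (m : ℕ) : Set ℝ := Set.Ico (m : ℝ) (m + 1 / m)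

theorem measurableSet_strip (m : ℕ) : MeasurableSet (strip m) := measurableSet_Ico

theorem volume_strip (m : ℕ) : volume (strip m) = ENNReal.ofReal (1 / m) := by
  simp [strip]

theorem strip_subset_Ico (m : ℕ) : strip m ⊆ Set.Ico (m : ℝ) (m + 1) := by
  refine Set.Ico_subset_Ico_right ?_
  gcongr
  simpa using Nat.cast_inv_le_one (α := ℝ) m

theorem eq_of_mem_strip_of_mem_Ico {m n : ℕ} {x : ℝ} (hm : x ∈ strip m)
    (hn : x ∈ Set.Ico (n : ℝ) (n + 1)) : m = n := by
  have hm' := strip_subset_Ico m hm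
  have h1 : (m : ℝ) < n + 1 := hm'.1.trans_lt hn.2
  have h2 : (n : ℝ) < m + 1 := hn.1.trans_lt hm'.2
  norm_cast at h1 h2
  lia

theorem pairwise_disjoint_strip : Pairwise (Function.onFun Disjoint strip) := fun _ _ h =>
  Set.disjoint_left.2 fun _ hm hn => h (eq_of_mem_strip_of_mem_Ico hm (strip_subset_Ico _ hn))

/-- The function equal to `c m` on `strip m` and to zero off the strips. -/
noncomputable def stripFun (c : ℕ → ℝ) (x : ℝ) : ℝ := ∑' m, (strip m).indicator (fun _ => c m) x

theorem stripFun_of_mem_Ico (c : ℕ → ℝ) {m : ℕ} {x : ℝ} (hx : x ∈ Set.Ico (m : ℝ) (m + 1)) :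
    stripFun c x = (strip m).indicator (fun _ => c m) x :=
  tsum_eq_single m fun _ hn =>
    Set.indicator_of_notMem (fun h => hn (eq_of_mem_strip_of_mem_Ico h hx)) _

theorem stripFun_of_mem (c : ℕ → ℝ) {m : ℕ} {x : ℝ} (hx : x ∈ strip m) : stripFun c x = c m := by
  rw [stripFun_of_mem_Ico c (strip_subset_Ico m hx), Set.indicator_of_mem hx]

theorem stripFun_of_notMem (c : ℕ → ℝ) {x : ℝ} (hx : x ∉ ⋃ m, strip m) : stripFun c x = 0 := by
  simp only [Set.mem_iUnion, not_exists] at hx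
  simp [stripFun, Set.indicator_of_notMem (hx _)]

theorem integrable_and_integral_comp_stripFun {c : ℕ → ℝ} {g : ℝ → ℝ} (hg : g 0 = 0)
    (hsum : Summable fun m : ℕ => g (c m) / m) :
    Integrable (fun x => g (stripFun c x)) ∧ ∫ x, g (stripFun c x) = ∑' m : ℕ, g (c m) / m := by
  have hzero : ∀ x ∉ ⋃ m, strip m, g (stripFun c x) = 0 := fun x hx => by
    rw [stripFun_of_notMem c hx, hg]
  have heq (m : ℕ) : Set.EqOn (fun x => g (stripFun c x)) (fun _ => g (c m)) (strip m) :=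
    fun x hx => by simp only [stripFun_of_mem c hx]
  have hfin (m : ℕ) : volume (strip m) ≠ ⊤ := by simp [volume_strip]
  have hreal (m : ℕ) : volume.real (strip m) = 1 / m := by
    rw [measureReal_def, volume_strip, ENNReal.toReal_ofReal (by positivity)]
  have hint (m : ℕ) : ∫ x in strip m, g (stripFun c x) = g (c m) / m := by
    rw [setIntegral_congr_fun (measurableSet_strip m) (heq m), setIntegral_const, hreal,
      smul_eq_mul]
    ring
  have hnorm (m : ℕ) : ∫ x in strip m, ‖g (stripFun c x)‖ = |g (c m) / m| := by
    rw [setIntegral_congr_fun (measurableSet_strip m) fun x hx => congrArg norm (heq m hx),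
      setIntegral_const, hreal, smul_eq_mul, abs_div, Nat.abs_cast, Real.norm_eq_abs]
    ring
  have hon : IntegrableOn (fun x => g (stripFun c x)) (⋃ m, strip m) := by
    refine integrableOn_iUnion_of_summable_integral_norm (fun m => ?_) ?_
    · exact (integrableOn_const (hfin m)).congr_fun (heq m).symm (measurableSet_strip m)
    · simpa only [hnorm] using hsum.abs
  refine ⟨(integrableOn_iff_integrable_of_support_subset
    (Function.support_subset_iff'.2 hzero)).1 hon, ?_⟩
  rw [← setIntegral_eq_integral_of_forall_compl_eq_zero hzero,
    integral_iUnion measurableSet_strip pairwise_disjoint_strip hon]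
  simp only [hint]

theorem withDensity_stripFun_floor_preimage_natCast {c : ℕ → ℝ} (m : ℕ) (hc : 0 ≤ c m) :
    (volume.withDensity fun x => ENNReal.ofReal (stripFun c x))
      ((fun x : ℝ => ⌊x⌋) ⁻¹' {(m : ℤ)}) = ENNReal.ofReal (c m / m) := by
  have hpre : (fun x : ℝ => ⌊x⌋) ⁻¹' {(m : ℤ)} = Set.Ico (m : ℝ) (m + 1) := by
    simp
  rw [hpre, withDensity_apply _ measurableSet_Ico]
  have heq : Set.EqOn (fun x => ENNReal.ofReal (stripFun c x))
      ((strip m).indicator fun _ => ENNReal.ofReal (c m)) (Set.Ico (m : ℝ) (m + 1)) := by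
    intro x hx
    by_cases h : x ∈ strip m <;> simp [stripFun_of_mem_Ico c hx, h]
  rw [setLIntegral_congr_fun measurableSet_Ico heq, lintegral_indicator_const
    (measurableSet_strip m), Measure.restrict_apply (measurableSet_strip m),
    Set.inter_eq_left.2 (strip_subset_Ico m), volume_strip, ← ENNReal.ofReal_mul hc, mul_one_div]

theorem withDensity_stripFun_floor_preimage_of_neg (c : ℕ → ℝ) {a : ℤ} (ha : a < 0) :
    (volume.withDensity fun x => ENNReal.ofReal (stripFun c x)) ((fun x : ℝ => ⌊x⌋) ⁻¹' {a}) =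
      0 := by
  have hmeas : MeasurableSet ((fun x : ℝ => ⌊x⌋) ⁻¹' {a}) :=
    Int.measurable_floor (measurableSet_singleton a)
  have heq : Set.EqOn (fun x => ENNReal.ofReal (stripFun c x)) (fun _ => 0)
      ((fun x : ℝ => ⌊x⌋) ⁻¹' {a}) := by
    intro x hx
    have hx0 : x < 0 := Int.floor_lt_zero.1 (by simpa [Set.mem_singleton_iff.1 hx] using ha)
    have hx' : x ∉ ⋃ m, strip m := by
      simp only [Set.mem_iUnion, not_exists]
      intro m hm
      exact (hx0.trans_le m.cast_nonneg).not_ge hm.1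
    simp [stripFun_of_notMem c hx']
  rw [withDensity_apply _ hmeas, setLIntegral_congr_fun hmeas heq, lintegral_zero]

theorem discEnt_floor_withDensity_stripFun {c : ℕ → ℝ} (hc : ∀ m, 0 ≤ c m) :
    discEnt (volume.withDensity fun x => ENNReal.ofReal (stripFun c x)) (fun x : ℝ => ⌊x⌋) =
      ∑' m : ℕ, ENNReal.ofReal (Real.negMulLog (c m / m)) := by
  rw [discEnt, ← Function.Injective.tsum_eq (g := ((↑) : ℕ → ℤ)) Nat.cast_injective]
  · refine tsum_congr fun m => ?_
    rw [withDensity_stripFun_floor_preimage_natCast m (hc m),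
      ENNReal.toReal_ofReal (div_nonneg (hc m) m.cast_nonneg)]
  · refine Function.support_subset_iff'.2 fun a ha => ?_
    have hneg : a < 0 := by
      by_contra! h
      exact ha ⟨a.toNat, Int.toNat_of_nonneg h⟩
    rw [withDensity_stripFun_floor_preimage_of_neg c hneg]
    simp

open Classical in
/-- The example source with `p_m = 1/(K·m·(log m)²)`: its density `f_X` integrates
to 1, the integer-part entropy `H(⌊X⌋) = Σ p_m log(1/p_m)` is infinite, while the
differential entropy is finite and equals `Σ (log K + 2 log log m)/(K·m·(log m)²)`. -/
theorem example_finite_diffEnt_infinite_floorEntropy :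
    ∀ K : ℝ, K = (∑' m : ℕ, if 2 ≤ m then 1 / (m * Real.log m ^ 2) else 0) →
    ∀ p : ℕ → ℝ, (∀ m, p m = if 2 ≤ m then 1 / (K * m * Real.log m ^ 2) else 0) →
    ∀ f : ℝ → ℝ,
      (∀ x, f x = ∑' m : ℕ, if (m : ℝ) ≤ x ∧ x < m + 1 / m then p m * m else 0) →
      (∫ x, f x = 1) ∧
        discEnt (volume.withDensity fun x => ENNReal.ofReal (f x)) (fun x : ℝ => ⌊x⌋) =
          (∑' m : ℕ, ENNReal.ofReal (p m * Real.log (1 / p m))) ∧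
        (∑' m : ℕ, ENNReal.ofReal (p m * Real.log (1 / p m))) = ⊤ ∧
        Integrable (fun x => f x * Real.log (f x)) volume ∧
        -∫ x, f x * Real.log (f x) =
          (∑' m : ℕ, if 2 ≤ m then
            (Real.log K + 2 * Real.log (Real.log m)) / (K * m * Real.log m ^ 2) else 0) ∧
        Summable (fun m : ℕ => if 2 ≤ m then
          (Real.log K + 2 * Real.log (Real.log m)) / (K * m * Real.log m ^ 2) else 0) := by
  intro K hK p hp f hf
  have drop_ite : ∀ u : ℕ → ℝ, ∀ m : ℕ,
      (if 2 ≤ m then u m / (m * Real.log m ^ 2) else 0) = u m / (m * Real.log m ^ 2) := by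
    intro u m
    split_ifs with h
    · rfl
    · interval_cases m <;> simp
  rw [tsum_congr (drop_ite fun _ => 1)] at hK
  have hp' (m : ℕ) : p m = K⁻¹ * (1 / (m * Real.log m ^ 2)) := by
    rw [hp, ← drop_ite fun _ => 1]
    split_ifs
    · simp only [one_div, mul_inv, mul_assoc]
    · simp
  set e : ℕ → ℝ := fun m =>
    K⁻¹ * ((Real.log K + 2 * Real.log (Real.log m)) / (m * Real.log m ^ 2)) with he
  have he' : (fun m : ℕ => if 2 ≤ m then
      (Real.log K + 2 * Real.log (Real.log m)) / (K * m * Real.log m ^ 2) else 0) = e := by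
    funext m
    simp only [he]
    rw [← drop_ite fun m => Real.log K + 2 * Real.log (Real.log m)]
    split_ifs
    · simp only [div_eq_mul_inv, mul_inv]
      ring
    · simp
  have hKpos : 0 < K := by
    rw [hK]
    refine summable_one_div_nat_mul_log_sq.tsum_pos (fun m => by positivity) 2 ?_
    have := Real.log_pos one_lt_two
    simp only [Nat.cast_ofNat]
    positivity
  have hp_nonneg (m : ℕ) : 0 ≤ p m := by
    rw [hp']
    positivity
  have hp_sum : HasSum p 1 := by
    have h := summable_one_div_nat_mul_log_sq.hasSum.mul_left K⁻¹
    rw [← hK, inv_mul_cancel₀ hKpos.ne'] at h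
    rwa [funext hp']
  have he_sum : Summable e := by
    refine Summable.mul_left _ ?_
    simpa only [add_div, mul_div_assoc, mul_one_div] using
      (summable_one_div_nat_mul_log_sq.mul_left (Real.log K)).add
        (summable_log_log_div_nat_mul_log_sq.mul_left 2)
  have hpm (m : ℕ) : p m * m / m = p m := by
    rcases eq_or_ne m 0 with rfl | hm
    · simp [hp]
    · field_simp
  have hentropy (m : ℕ) : p m * m * Real.log (p m * m) / m = -e m := by
    rw [mul_div_right_comm, hpm]
    rcases lt_or_ge m 2 with hm | hm
    · interval_cases m <;> simp [hp', he]
    · have hm0 : (0 : ℝ) < m := by positivity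
      have hlog : 0 < Real.log m := Real.log_pos (by exact_mod_cast hm)
      have : p m * m = (K * Real.log m ^ 2)⁻¹ := by
        rw [hp']
        field_simp
      rw [this, Real.log_inv, Real.log_mul hKpos.ne' (by positivity), Real.log_pow, hp', he]
      push_cast
      ring
  have hfloor (m : ℕ) : p m * Real.log (1 / p m) = K⁻¹ * (1 / (m * Real.log m)) + e m := by
    rcases lt_or_ge m 2 with hm | hm
    · interval_cases m <;> simp [hp', he]
    · have hm0 : (0 : ℝ) < m := by positivity
      have hlog : 0 < Real.log m := Real.log_pos (by exact_mod_cast hm)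
      have : 1 / p m = K * (m * Real.log m ^ 2) := by
        rw [hp']
        field_simp
      rw [this, Real.log_mul hKpos.ne' (by positivity), Real.log_mul hm0.ne' (by positivity),
        Real.log_pow, hp', he]
      push_cast
      field_simp
      ring
  have hf' : f = stripFun fun m => p m * m := by
    funext x
    rw [hf, stripFun]
    refine tsum_congr fun m => ?_
    simp only [Set.indicator_apply, strip, Set.mem_Ico]
  have hmass := integrable_and_integral_comp_stripFun (c := fun m => p m * m) (g := id) rfl
    (by simpa only [id, hpm] using hp_sum.summable)
  have hent := integrable_and_integral_comp_stripFun (c := fun m => p m * m)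
    (g := fun t => t * Real.log t) (by simp) (by simpa only [hentropy] using he_sum.neg)
  rw [he']
  subst hf'
  refine ⟨?_, ?_, ?_, hent.1, ?_, he_sum⟩
  · simpa only [id, hpm, hp_sum.tsum_eq] using hmass.2
  · rw [discEnt_floor_withDensity_stripFun fun m => mul_nonneg (hp_nonneg m) m.cast_nonneg]
    refine tsum_congr fun m => ?_
    rw [hpm, Real.negMulLog, one_div, Real.log_inv, neg_mul_comm]
  · by_contra htop
    have hnonneg (m : ℕ) : 0 ≤ p m * Real.log (1 / p m) := by
      have hle : p m ≤ 1 := le_hasSum hp_sum m fun j _ => hp_nonneg j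
      rw [one_div, Real.log_inv]
      exact mul_nonneg (hp_nonneg m) (neg_nonneg.2 (Real.log_nonpos (hp_nonneg m) hle))
    have hsum := ENNReal.summable_toReal htop
    simp only [ENNReal.toReal_ofReal (hnonneg _)] at hsum
    simp only [hfloor] at hsum
    have hdiff := hsum.sub he_sum
    simp only [add_sub_cancel_right] at hdiff
    exact not_summable_one_div_nat_mul_log
      ((summable_mul_left_iff (inv_ne_zero hKpos.ne')).1 hdiff)
  · rw [hent.2]
    simp only [hentropy, tsum_neg, neg_neg]
end
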